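/- arXiv:1906.07819 — 6 statements merged into one kernel-verified Lean document; each statement's English description precedes it below -/
import Mathlib

section
/- Let χ be the characteristic function of the set of practical numbers and θ(n) = σ(n) + 1. Then Σ_{n ≥ 1} χ(n)·(1/n)·log(σ(n)/n)·∏_{p ≤ θ(n)} (1 − 1/p) = Σ_{n ≥ 1} χ(n)·(1/n)·(Σ_{q ≤ θ(n)} W_q)·∏_{p ≤ θ(n)} (1 − 1/p), where p and q run over primes, both series converging. -/
open scoped BigOperators
open Classical

/-- A positive integer `n` is practical if every positive integer `m ≤ n` can be
expressed as a sum of distinct positive divisors of `n`. -/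
def Practical (n : ℕ) : Prop :=
  0 < n ∧ ∀ m : ℕ, 0 < m → m ≤ n → ∃ s : Finset ℕ, s ⊆ n.divisors ∧ ∑ d ∈ s, d = m

/-- The sum of the positive divisors of `n`. -/
def sigma1 (n : ℕ) : ℕ := ∑ d ∈ n.divisors, d

/-- The set of primes `p ≤ x`. -/
noncomputable def primesUpTo (x : ℝ) : Finset ℕ := (Finset.Iic ⌊x⌋₊).filter Nat.Prime

/-- `W_q = Σ_{h ≥ 1} ((1 − 1/q)/q^h)·log((1 − 1/q^{h+1})/(1 − 1/q))`
(the index `h : ℕ` below corresponds to `h + 1 ≥ 1`). -/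
noncomputable def W (q : ℕ) : ℝ :=
  ∑' h : ℕ, ((1 - 1 / (q : ℝ)) / (q : ℝ) ^ (h + 1)) *
    Real.log ((1 - 1 / (q : ℝ) ^ (h + 2)) / (1 - 1 / (q : ℝ)))

section PracticalSums

open Filter Topology

/-- The positive integers all of whose prime factors are less than `N`. -/
def smoothBelow (N : ℕ) : Set ℕ := {m | 0 < m ∧ ∀ p : ℕ, p.Prime → p ∣ m → p < N}

/-- Every prime factor `p` of `n` exceeds the sum of the `p`-smooth divisors of `n`
by at most one. -/
def PrimeChain (n : ℕ) : Prop :=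
  ∀ p : ℕ, p.Prime → p ∣ n → p ≤ 1 + ∑ d ∈ n.divisors.filter (· ∈ smoothBelow p), d

/-- Every `m ≤ σ(n)` is a sum of distinct divisors of `n`. -/
def DivisorSumsFull (n : ℕ) : Prop :=
  ∀ m : ℕ, m ≤ sigma1 n → ∃ s : Finset ℕ, s ⊆ n.divisors ∧ ∑ d ∈ s, d = m

lemma sigma1_eq (n : ℕ) : sigma1 n = ArithmeticFunction.sigma 1 n := by
  simp [sigma1, ArithmeticFunction.sigma_one_apply]

lemma le_sigma1 {n : ℕ} (hn : 0 < n) : n ≤ sigma1 n :=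
  Finset.single_le_sum (f := fun d => d) (fun _ _ => Nat.zero_le _)
    (Nat.mem_divisors_self n hn.ne')

lemma Practical.primeChain {n : ℕ} (h : Practical n) : PrimeChain n := by
  intro p hp hpn
  by_contra! hlt
  set S := ∑ d ∈ n.divisors.filter (· ∈ smoothBelow p), d with hS
  have hple := Nat.le_of_dvd h.1 hpn
  obtain ⟨s, hs, hsum⟩ := h.2 (1 + S) (by omega) (by omega)
  have hsub : s ⊆ n.divisors.filter (· ∈ smoothBelow p) := by
    intro d hd
    have hdle : d ≤ ∑ d ∈ s, d :=
      Finset.single_le_sum (f := fun d => d) (fun _ _ => Nat.zero_le _) hd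
    have hd0 := Nat.pos_of_mem_divisors (hs hd)
    refine Finset.mem_filter.2 ⟨hs hd, hd0, fun q _ hqd => ?_⟩
    have := Nat.le_of_dvd hd0 hqd
    omega
  have := Finset.sum_le_sum_of_subset (f := fun d => d) hsub
  omega

lemma coprime_of_mem_smoothBelow {p k : ℕ} (hp : p.Prime) (hk : k ∈ smoothBelow p) :
    Nat.Coprime p k :=
  (Nat.Prime.coprime_iff_not_dvd hp).2 fun h => lt_irrefl _ (hk.2 p hp h)

lemma mem_smoothBelow_of_dvd {N d k : ℕ} (hk : k ∈ smoothBelow N) (hd : d ∣ k) :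
    d ∈ smoothBelow N :=
  ⟨Nat.pos_of_dvd_of_pos hd hk.1, fun q hq hqd => hk.2 q hq (hqd.trans hd)⟩

lemma filter_divisors_pow_mul {p k a q : ℕ} (hp : p.Prime) (hk : k ∈ smoothBelow p)
    (hq : q ≤ p) :
    (p ^ a * k).divisors.filter (· ∈ smoothBelow q)
      = k.divisors.filter (· ∈ smoothBelow q) := by
  ext d
  simp only [Finset.mem_filter, Nat.mem_divisors]
  constructor
  · rintro ⟨⟨hd, _⟩, hs⟩
    refine ⟨⟨?_, hk.1.ne'⟩, hs⟩
    have hc : Nat.Coprime d (p ^ a) := by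
      refine Nat.Coprime.pow_right _ (Nat.Coprime.symm ?_)
      exact (Nat.Prime.coprime_iff_not_dvd hp).2 fun h => by
        have := hs.2 p hp h
        omega
    exact hc.dvd_of_dvd_mul_left hd
  · rintro ⟨⟨hd, _⟩, hs⟩
    exact ⟨⟨hd.mul_left _, mul_ne_zero (pow_ne_zero _ hp.ne_zero) hk.1.ne'⟩, hs⟩

lemma filter_divisors_self {N k : ℕ} (hk : k ∈ smoothBelow N) :
    k.divisors.filter (· ∈ smoothBelow N) = k.divisors :=
  Finset.filter_true_of_mem fun _ hd =>
    mem_smoothBelow_of_dvd hk (Nat.dvd_of_mem_divisors hd)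

lemma primeChain_pow_mul {p k a : ℕ} (hp : p.Prime) (hk : k ∈ smoothBelow p)
    (h : PrimeChain (p ^ a * k)) : PrimeChain k ∧ (a = 0 ∨ p ≤ sigma1 k + 1) := by
  constructor
  · intro q hq hqk
    have := h q hq (hqk.mul_left _)
    rwa [filter_divisors_pow_mul hp hk (hk.2 q hq hqk).le] at this
  · rcases Nat.eq_zero_or_pos a with h0 | h0
    · exact Or.inl h0
    · right
      have := h p hp ((dvd_pow_self p h0.ne').mul_right _)
      rw [filter_divisors_pow_mul hp hk le_rfl, filter_divisors_self hk] at this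
      unfold sigma1
      omega

lemma sigma1_pow_mul {p k : ℕ} (a : ℕ) (hp : p.Prime) (hk : k ∈ smoothBelow p) :
    sigma1 (p ^ a * k) = (∑ i ∈ Finset.range (a + 1), p ^ i) * sigma1 k := by
  have hc : Nat.Coprime (p ^ a) k := (coprime_of_mem_smoothBelow hp hk).pow_left a
  rw [sigma1_eq, ArithmeticFunction.isMultiplicative_sigma.map_mul_of_coprime hc,
    ← sigma1_eq, ← sigma1_eq]
  congr 1
  simp [sigma1, Nat.divisors_prime_pow hp]

lemma DivisorSumsFull.pow_mul {p k : ℕ} (hp : p.Prime) (hk : k ∈ smoothBelow p)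
    (h : DivisorSumsFull k) (hle : p ≤ sigma1 k + 1) (a : ℕ) :
    DivisorSumsFull (p ^ a * k) := by
  induction a with
  | zero => simpa using h
  | succ a ih =>
    intro m hm
    have h1 := sigma1_pow_mul a hp hk
    have h2 := sigma1_pow_mul (a + 1) hp hk
    rw [Finset.sum_range_succ, add_mul, ← h1] at h2
    have hgeom : p ^ (a + 1) ≤ sigma1 (p ^ a * k) + 1 := by
      have := Nat.geomSum_eq hp.two_le (a + 1)
      have hg : (p - 1) * ∑ i ∈ Finset.range (a + 1), p ^ i = p ^ (a + 1) - 1 := by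
        have := Nat.geomSum_eq hp.two_le (a + 1)
        rw [this, Nat.mul_div_cancel']
        simpa using Nat.sub_dvd_pow_sub_pow p 1 (a + 1)
      have : (p - 1) * ∑ i ∈ Finset.range (a + 1), p ^ i
          ≤ sigma1 k * ∑ i ∈ Finset.range (a + 1), p ^ i := Nat.mul_le_mul_right _ (by omega)
      rw [h1, mul_comm _ (sigma1 k)]
      omega
    have hpos : 0 < p ^ (a + 1) := pow_pos hp.pos _
    obtain ⟨t, ht, htm, hmt⟩ : ∃ t ≤ sigma1 k, p ^ (a + 1) * t ≤ m ∧
        m - p ^ (a + 1) * t ≤ sigma1 (p ^ a * k) := by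
      rcases le_total (m / p ^ (a + 1)) (sigma1 k) with hc | hc
      · refine ⟨m / p ^ (a + 1), hc, Nat.mul_div_le _ _, ?_⟩
        have := Nat.div_add_mod m (p ^ (a + 1))
        have := Nat.mod_lt m hpos
        omega
      · refine ⟨sigma1 k, le_rfl, ?_, ?_⟩
        · exact (Nat.mul_le_mul_left _ hc).trans (Nat.mul_div_le _ _)
        · omega
    obtain ⟨s, hs, hssum⟩ := h t ht
    obtain ⟨r, hr, hrsum⟩ := ih _ hmt
    have hk0 := hk.1.ne'
    have hdisj : Disjoint r (s.image (p ^ (a + 1) * ·)) := by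
      rw [Finset.disjoint_left]
      intro d hd hd'
      obtain ⟨e, -, rfl⟩ := Finset.mem_image.1 hd'
      have h3 := Nat.dvd_of_mem_divisors (hr hd)
      rw [pow_succ, mul_assoc] at h3
      have h4 := Nat.dvd_of_mul_dvd_mul_left (pow_pos hp.pos a) h3
      exact lt_irrefl _ (hk.2 p hp (dvd_of_mul_right_dvd h4))
    refine ⟨r ∪ s.image (p ^ (a + 1) * ·), ?_, ?_⟩
    · intro d hd
      rcases Finset.mem_union.1 hd with hd | hd
      · refine Nat.mem_divisors.2 ⟨(Nat.dvd_of_mem_divisors (hr hd)).trans ?_,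
          mul_ne_zero hpos.ne' hk0⟩
        exact Nat.mul_dvd_mul_right (pow_dvd_pow p (Nat.le_succ a)) k
      · obtain ⟨e, he, rfl⟩ := Finset.mem_image.1 hd
        exact Nat.mem_divisors.2 ⟨Nat.mul_dvd_mul_left _ (Nat.dvd_of_mem_divisors (hs he)),
          mul_ne_zero hpos.ne' hk0⟩
    · rw [Finset.sum_union hdisj, Finset.sum_image, ← Finset.mul_sum, hssum, hrsum]
      · omega
      · intro x _ y _ hxy
        exact Nat.eq_of_mul_eq_mul_left hpos hxy

lemma DivisorSumsFull.practical {n : ℕ} (hn : 0 < n) (h : DivisorSumsFull n) : Practical n :=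
  ⟨hn, fun m _ hm => h m (hm.trans (le_sigma1 hn))⟩

lemma exists_eq_pow_mul {p n : ℕ} (hp : p.Prime) (hn : n ∈ smoothBelow (p + 1)) :
    ∃ a, ∃ k ∈ smoothBelow p, n = p ^ a * k := by
  obtain ⟨a, k, hpk, rfl⟩ := Nat.exists_eq_pow_mul_and_not_dvd hn.1.ne' p hp.ne_one
  refine ⟨a, k, ⟨Nat.pos_of_ne_zero fun h => by simp [h] at hpk, fun q hq hqk => ?_⟩, rfl⟩
  have := hn.2 q hq (hqk.mul_left _)
  have : q ≠ p := by rintro rfl; exact hpk hqk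
  omega

lemma smoothBelow_succ_of_not_prime {N : ℕ} (hN : ¬ N.Prime) :
    smoothBelow (N + 1) = smoothBelow N := by
  ext m
  refine and_congr_right fun _ => ⟨fun h p hp hpm => ?_, fun h p hp hpm => ?_⟩
  · have := h p hp hpm
    have : p ≠ N := by rintro rfl; exact hN hp
    omega
  · have := h p hp hpm
    omega

lemma smoothBelow_zero : smoothBelow 0 = {1} := by
  ext m
  simp only [smoothBelow, Set.mem_ofPred_eq, Set.mem_singleton_iff, not_lt_zero, imp_false]
  constructor
  · rintro ⟨_, h⟩
    by_contra h1
    obtain ⟨p, hp, hpm⟩ := Nat.exists_prime_and_dvd h1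
    exact h p hp hpm
  · rintro rfl
    exact ⟨one_pos, fun p hp h => hp.one_lt.ne' (Nat.dvd_one.1 h)⟩

lemma mem_smoothBelow_of_lt {m N : ℕ} (h0 : 0 < m) (h : m < N) : m ∈ smoothBelow N :=
  ⟨h0, fun _ _ hd => (Nat.le_of_dvd h0 hd).trans_lt h⟩

lemma PrimeChain.divisorSumsFull {N n : ℕ} (hn : n ∈ smoothBelow N) (h : PrimeChain n) :
    DivisorSumsFull n := by
  induction N generalizing n with
  | zero =>
    rw [smoothBelow_zero, Set.mem_singleton_iff] at hn
    subst hn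
    intro m hm
    have hm' : m ≤ 1 := by simpa [sigma1] using hm
    interval_cases m
    · exact ⟨∅, by simp, by simp⟩
    · exact ⟨{1}, by simp, by simp⟩
  | succ N ih =>
    by_cases hN : N.Prime
    · obtain ⟨a, k, hk, rfl⟩ := exists_eq_pow_mul hN hn
      obtain ⟨h1, h2⟩ := primeChain_pow_mul hN hk h
      rcases h2 with rfl | h2
      · simpa using ih hk h1
      · exact (ih hk h1).pow_mul hN hk h2 a
    · rw [smoothBelow_succ_of_not_prime hN] at hn
      exact ih hn h

lemma Practical.divisorSumsFull {n : ℕ} (h : Practical n) : DivisorSumsFull n :=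
  h.primeChain.divisorSumsFull (mem_smoothBelow_of_lt h.1 (Nat.lt_succ_self n))

lemma practical_pow_mul_iff {p k : ℕ} (a : ℕ) (hp : p.Prime) (hk : k ∈ smoothBelow p) :
    Practical (p ^ a * k) ↔ Practical k ∧ (a = 0 ∨ p ≤ sigma1 k + 1) := by
  constructor
  · intro h
    obtain ⟨h1, h2⟩ := primeChain_pow_mul hp hk h.primeChain
    exact ⟨(h1.divisorSumsFull hk).practical hk.1, h2⟩
  · rintro ⟨h1, rfl | h2⟩
    · simpa using h1
    · exact (h1.divisorSumsFull.pow_mul hp hk h2 a).practical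
        (Nat.mul_pos (pow_pos hp.pos _) hk.1)

/-- The set of all products of a power of `p` and an element of `X`. -/
def powMulSet (p : ℕ) (X : Set ℕ) : Set ℕ := {m | ∃ a : ℕ, ∃ k ∈ X, m = p ^ a * k}

lemma pow_mul_injective {p : ℕ} (hp : p.Prime) {X : Set ℕ} (hX : X ⊆ smoothBelow p) :
    Function.Injective (fun x : ℕ × X => p ^ x.1 * (x.2 : ℕ)) := by
  have key : ∀ a k, k ∈ X → (p ^ a * k).factorization p = a := by
    intro a k hk
    have h0 := (hX hk).1.ne'
    have hnd : ¬ p ∣ k := fun h => lt_irrefl _ ((hX hk).2 p hp h)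
    rw [Nat.factorization_mul (pow_ne_zero _ hp.ne_zero) h0]
    simp [hp.factorization_self, Nat.factorization_eq_zero_of_not_dvd hnd]
  rintro ⟨a, k, hk⟩ ⟨b, l, hl⟩ h
  simp only at h
  have hab : a = b := by rw [← key a k hk, h, key b l hl]
  subst hab
  have := Nat.eq_of_mul_eq_mul_left (pow_pos hp.pos a) h
  subst this
  rfl

lemma HasSum.mul_real {ι κ : Type*} {f : ι → ℝ} {g : κ → ℝ} {s t : ℝ} (hf : HasSum f s)
    (hg : HasSum g t) : HasSum (fun x : ι × κ => f x.1 * g x.2) (s * t) :=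
  hf.mul hg (summable_mul_of_summable_norm hf.summable.norm hg.summable.norm)

lemma hasSum_powMulSet {p : ℕ} (hp : p.Prime) {X : Set ℕ} (hX : X ⊆ smoothBelow p)
    {F α β : ℕ → ℝ} (hF : ∀ a, ∀ k ∈ X, F (p ^ a * k) = α a * F k + β a)
    {s r A B : ℝ} (hs : HasSum (X.indicator fun m => F m / m) s)
    (hr : HasSum (X.indicator fun m => 1 / (m : ℝ)) r)
    (hA : HasSum (fun a => α a / (p : ℝ) ^ a) A) (hB : HasSum (fun a => β a / (p : ℝ) ^ a) B) :
    HasSum ((powMulSet p X).indicator fun m => F m / m) (A * s + B * r) := by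
  rw [← hasSum_subtype_iff_indicator] at hs hr
  have h1 := hA.mul_real hs
  have h2 := hB.mul_real hr
  refine ((pow_mul_injective hp hX).hasSum_iff ?_).1 ?_
  · intro m hm
    refine Set.indicator_of_notMem ?_ _
    rintro ⟨a, k, hk, rfl⟩
    exact hm ⟨(a, ⟨k, hk⟩), rfl⟩
  · have h3 := h1.add h2
    convert h3 using 1
    funext ⟨a, k, hk⟩
    have hk0 : (k : ℝ) ≠ 0 := Nat.cast_ne_zero.2 (hX hk).1.ne'
    have hp0 : (p : ℝ) ≠ 0 := Nat.cast_ne_zero.2 hp.ne_zero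
    have hmem : p ^ a * k ∈ powMulSet p X := ⟨a, k, hk, rfl⟩
    simp only [Function.comp_apply, Set.indicator_of_mem hmem, hF a k hk]
    push_cast
    field_simp

lemma powMulSet_smoothBelow {p : ℕ} (hp : p.Prime) :
    powMulSet p (smoothBelow p) = smoothBelow (p + 1) := by
  ext m
  constructor
  · rintro ⟨a, k, hk, rfl⟩
    refine ⟨Nat.mul_pos (pow_pos hp.pos _) hk.1, fun q hq hqd => ?_⟩
    rcases (Nat.Prime.dvd_mul hq).1 hqd with h | h
    · have := (Nat.prime_dvd_prime_iff_eq hq hp).1 (hq.dvd_of_dvd_pow h)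
      omega
    · have := hk.2 q hq h
      omega
  · exact fun h => exists_eq_pow_mul hp h

/-- The practical numbers `m` composed of primes less than `N` with `σ(m) + 1 ≥ N`. -/
def openPractical (N : ℕ) : Set ℕ :=
  {m | m ∈ smoothBelow N ∧ Practical m ∧ N ≤ sigma1 m + 1}

/-- The practical numbers `m` with `σ(m) + 1 = N`. -/
noncomputable def practicalAt (N : ℕ) : Finset ℕ :=
  (Finset.range N).filter fun m => Practical m ∧ sigma1 m + 1 = N

/-- The practical numbers `m` with `σ(m) + 1 < N`. -/
noncomputable def practicalBelow (N : ℕ) : Finset ℕ :=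
  (Finset.range N).filter fun m => Practical m ∧ sigma1 m + 1 < N

lemma mem_practicalAt {N m : ℕ} : m ∈ practicalAt N ↔ Practical m ∧ sigma1 m + 1 = N := by
  refine ⟨fun h => (Finset.mem_filter.1 h).2, fun h => Finset.mem_filter.2 ⟨?_, h⟩⟩
  have := le_sigma1 h.1.1
  rw [Finset.mem_range]
  omega

lemma mem_practicalBelow {N m : ℕ} :
    m ∈ practicalBelow N ↔ Practical m ∧ sigma1 m + 1 < N := by
  refine ⟨fun h => (Finset.mem_filter.1 h).2, fun h => Finset.mem_filter.2 ⟨?_, h⟩⟩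
  have := le_sigma1 h.1.1
  rw [Finset.mem_range]
  omega

lemma sum_practicalBelow_succ (N : ℕ) (u : ℕ → ℝ) :
    ∑ m ∈ practicalBelow (N + 1), u m
      = ∑ m ∈ practicalBelow N, u m + ∑ m ∈ practicalAt N, u m := by
  rw [← Finset.sum_union]
  · refine Finset.sum_congr ?_ fun _ _ => rfl
    ext m
    simp only [Finset.mem_union, mem_practicalAt, mem_practicalBelow, ← and_or_left]
    refine and_congr_right fun _ => ?_
    omega
  · rw [Finset.disjoint_left]
    intro m h1 h2
    have := (mem_practicalBelow.1 h1).2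
    have := (mem_practicalAt.1 h2).2
    omega

lemma mem_smoothBelow_of_mem_practicalAt {N m : ℕ} (h : m ∈ practicalAt N) :
    m ∈ smoothBelow N := by
  obtain ⟨h1, h2⟩ := mem_practicalAt.1 h
  have := le_sigma1 h1.1
  exact mem_smoothBelow_of_lt h1.1 (by omega)

lemma powMulSet_openPractical {p : ℕ} (hp : p.Prime) :
    powMulSet p (openPractical p) = openPractical (p + 1) ∪ ↑(practicalAt p) := by
  ext m
  simp only [Set.mem_union, Finset.mem_coe, mem_practicalAt]
  constructor
  · rintro ⟨a, k, ⟨hk, hkp, hle⟩, rfl⟩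
    have hpr := (practical_pow_mul_iff a hp hk).2 ⟨hkp, Or.inr hle⟩
    by_cases heq : sigma1 (p ^ a * k) + 1 = p
    · exact Or.inr ⟨hpr, heq⟩
    · refine Or.inl ⟨(powMulSet_smoothBelow hp).subset ⟨a, k, hk, rfl⟩, hpr, ?_⟩
      rcases Nat.eq_zero_or_pos a with rfl | ha
      · simp only [pow_zero, one_mul] at heq ⊢
        omega
      · have h1 : p ^ a * k ≤ _ := le_sigma1 hpr.1
        have h2 := Nat.le_of_dvd hpr.1 ((dvd_pow_self p ha.ne').mul_right k)
        omega
  · rintro (⟨hs, hpr, hle⟩ | ⟨hpr, heq⟩)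
    · obtain ⟨a, k, hk, rfl⟩ := exists_eq_pow_mul hp hs
      obtain ⟨hkp, rfl | h⟩ := (practical_pow_mul_iff a hp hk).1 hpr
      · simp only [pow_zero, one_mul] at hle
        exact ⟨0, k, ⟨hk, hkp, by omega⟩, rfl⟩
      · exact ⟨a, k, ⟨hk, hkp, h⟩, rfl⟩
    · exact ⟨0, m, ⟨mem_smoothBelow_of_mem_practicalAt (mem_practicalAt.2 ⟨hpr, heq⟩), hpr,
        heq.ge⟩, by simp⟩

lemma openPractical_of_not_prime {N : ℕ} (hN : ¬ N.Prime) :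
    openPractical N = openPractical (N + 1) ∪ ↑(practicalAt N) := by
  ext m
  simp only [Set.mem_union, Finset.mem_coe]
  constructor
  · rintro ⟨hs, hpr, hle⟩
    rcases hle.eq_or_lt with h | h
    · exact Or.inr (mem_practicalAt.2 ⟨hpr, h.symm⟩)
    · exact Or.inl ⟨(smoothBelow_succ_of_not_prime hN).symm.subset hs, hpr, h⟩
  · rintro (⟨hs, hpr, hle⟩ | h)
    · exact ⟨(smoothBelow_succ_of_not_prime hN).subset hs, hpr, by omega⟩
    · obtain ⟨hpr, heq⟩ := mem_practicalAt.1 h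
      exact ⟨mem_smoothBelow_of_mem_practicalAt h, hpr, heq.ge⟩

lemma hasSum_openPractical_succ {N : ℕ} {u : ℕ → ℝ} {s : ℝ}
    (hs : HasSum ((openPractical (N + 1) ∪ ↑(practicalAt N)).indicator u) s) :
    HasSum ((openPractical (N + 1)).indicator u) (s - ∑ m ∈ practicalAt N, u m) := by
  have hd : Disjoint (openPractical (N + 1)) (↑(practicalAt N) : Set ℕ) := by
    rw [Set.disjoint_left]
    rintro m ⟨-, -, h⟩ h'
    have := (mem_practicalAt.1 h').2
    omega
  have h2 : HasSum ((↑(practicalAt N) : Set ℕ).indicator u) (∑ m ∈ practicalAt N, u m) :=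
    hasSum_subtype_iff_indicator.1 ((practicalAt N).hasSum u)
  rw [Set.indicator_union_of_disjoint hd] at hs
  simpa using hs.sub h2

/-- `∏_{p < N} (1 - 1/p)`. -/
noncomputable def mertens (N : ℕ) : ℝ := ∏ p ∈ Nat.primesBelow N, (1 - 1 / (p : ℝ))

lemma one_sub_inv_pos {p : ℕ} (hp : p.Prime) : 0 < 1 - 1 / (p : ℝ) := by
  have : (1 : ℝ) < p := by exact_mod_cast hp.one_lt
  rw [sub_pos, div_lt_one (by linarith)]
  exact this

lemma mertens_pos (N : ℕ) : 0 < mertens N :=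
  Finset.prod_pos fun _ hp => one_sub_inv_pos (Nat.mem_primesBelow.1 hp).2

lemma primesBelow_succ_of_prime {p : ℕ} (hp : p.Prime) :
    Nat.primesBelow (p + 1) = insert p (Nat.primesBelow p) := by
  rw [Nat.primesBelow_succ, if_pos hp]

lemma primesBelow_succ_of_not_prime {p : ℕ} (hp : ¬ p.Prime) :
    Nat.primesBelow (p + 1) = Nat.primesBelow p := by
  rw [Nat.primesBelow_succ, if_neg hp]

lemma notMem_primesBelow_self (p : ℕ) : p ∉ Nat.primesBelow p := by
  simp [Nat.mem_primesBelow]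

lemma mertens_succ_of_prime {p : ℕ} (hp : p.Prime) :
    mertens (p + 1) = (1 - 1 / (p : ℝ)) * mertens p := by
  rw [mertens, primesBelow_succ_of_prime hp, Finset.prod_insert (notMem_primesBelow_self p)]
  rfl

lemma mertens_succ_of_not_prime {p : ℕ} (hp : ¬ p.Prime) : mertens (p + 1) = mertens p := by
  rw [mertens, primesBelow_succ_of_not_prime hp]
  rfl

/-- `log (σ(m) / m)`. -/
noncomputable def logAbundancy (m : ℕ) : ℝ := Real.log ((sigma1 m : ℝ) / m)

lemma logAbundancy_nonneg (m : ℕ) : 0 ≤ logAbundancy m := by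
  rcases Nat.eq_zero_or_pos m with rfl | h
  · simp [logAbundancy]
  · refine Real.log_nonneg ((one_le_div (by exact_mod_cast h)).2 ?_)
    exact_mod_cast le_sigma1 h

lemma abundancy_pow_mul {p k : ℕ} (a : ℕ) (hp : p.Prime) (hk : k ∈ smoothBelow p) :
    (sigma1 (p ^ a * k) : ℝ) / (p ^ a * k : ℕ)
      = ((sigma1 (p ^ a) : ℝ) / (p ^ a : ℕ)) * ((sigma1 k : ℝ) / k) := by
  have h1 : (1 : ℕ) ∈ smoothBelow p :=
    mem_smoothBelow_of_lt one_pos hp.one_lt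
  have h := sigma1_pow_mul a hp h1
  rw [sigma1_pow_mul a hp hk]
  simp only [mul_one] at h
  rw [h]
  simp only [sigma1, Nat.divisors_one, Finset.sum_singleton, mul_one]
  push_cast
  rw [mul_div_mul_comm]

lemma abundancy_pos {m : ℕ} (hm : 0 < m) : 0 < (sigma1 m : ℝ) / m := by
  have : 0 < sigma1 m := hm.trans_le (le_sigma1 hm)
  positivity

lemma logAbundancy_pow_mul {p k : ℕ} (a : ℕ) (hp : p.Prime) (hk : k ∈ smoothBelow p) :
    logAbundancy (p ^ a * k) = logAbundancy k + logAbundancy (p ^ a) := by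
  rw [logAbundancy, abundancy_pow_mul a hp hk, Real.log_mul, add_comm]
  · rfl
  · exact (abundancy_pos (pow_pos hp.pos a)).ne'
  · exact (abundancy_pos hk.1).ne'

lemma abundancy_prime_pow {p : ℕ} (hp : p.Prime) (a : ℕ) :
    (sigma1 (p ^ a) : ℝ) / (p ^ a : ℕ)
      = (1 - 1 / (p : ℝ) ^ (a + 1)) / (1 - 1 / (p : ℝ)) := by
  have h1 : (1 : ℕ) ∈ smoothBelow p := mem_smoothBelow_of_lt one_pos hp.one_lt
  have h := sigma1_pow_mul a hp h1
  simp only [mul_one, sigma1, Nat.divisors_one, Finset.sum_singleton] at h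
  have hp1 : (1 : ℝ) < p := by exact_mod_cast hp.one_lt
  have hp0 : (p : ℝ) ≠ 0 := by linarith
  have hp2 : (p : ℝ) - 1 ≠ 0 := by linarith
  unfold sigma1
  rw [h]
  push_cast
  rw [geom_sum_eq hp1.ne']
  field_simp
  ring

lemma HasSum.congr_real {f g : ℕ → ℝ} {s t : ℝ} (h : HasSum f s) (hfg : ∀ a, g a = f a)
    (hst : t = s) : HasSum g t := by
  rw [hst, funext hfg]
  exact h

lemma hasSum_zero_div_pow (p : ℕ) : HasSum (fun a : ℕ => (0 : ℝ) / (p : ℝ) ^ a) 0 :=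
  hasSum_zero.congr_real (fun _ => zero_div _) rfl

lemma hasSum_one_div_pow {p : ℕ} (hp : p.Prime) :
    HasSum (fun a : ℕ => 1 / (p : ℝ) ^ a) (1 / (1 - 1 / (p : ℝ))) := by
  have h := one_sub_inv_pos hp
  have h0 : (0 : ℝ) ≤ 1 / p := by positivity
  simpa [one_div] using hasSum_geometric_of_lt_one h0 (by linarith)

lemma one_lt_cast_prime {p : ℕ} (hp : p.Prime) : (1 : ℝ) < p := by exact_mod_cast hp.one_lt

lemma logAbundancy_prime_pow_le {p : ℕ} (hp : p.Prime) (a : ℕ) :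
    logAbundancy (p ^ a) ≤ 1 / ((p : ℝ) - 1) := by
  have h1 := one_lt_cast_prime hp
  have h2 := abundancy_pos (pow_pos hp.pos a)
  have h3 := Real.log_le_sub_one_of_pos h2
  have h4 : (sigma1 (p ^ a) : ℝ) / (p ^ a : ℕ) ≤ 1 / (1 - 1 / (p : ℝ)) := by
    rw [abundancy_prime_pow hp]
    have := one_sub_inv_pos hp
    gcongr
    have : (0 : ℝ) ≤ 1 / (p : ℝ) ^ (a + 1) := by positivity
    linarith
  have h5 : 1 / (1 - 1 / (p : ℝ)) - 1 = 1 / ((p : ℝ) - 1) := by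
    have : (p : ℝ) - 1 ≠ 0 := by linarith
    field_simp
    ring
  unfold logAbundancy
  linarith

lemma W_term_eq {p : ℕ} (hp : p.Prime) (h : ℕ) :
    ((1 - 1 / (p : ℝ)) / (p : ℝ) ^ (h + 1)) *
      Real.log ((1 - 1 / (p : ℝ) ^ (h + 2)) / (1 - 1 / (p : ℝ)))
      = (1 - 1 / (p : ℝ)) * (logAbundancy (p ^ (h + 1)) / (p : ℝ) ^ (h + 1)) := by
  rw [logAbundancy, abundancy_prime_pow hp]
  ring

lemma summable_logAbundancy_prime_pow {p : ℕ} (hp : p.Prime) :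
    Summable fun a : ℕ => logAbundancy (p ^ a) / (p : ℝ) ^ a := by
  refine Summable.of_nonneg_of_le (fun a => div_nonneg (logAbundancy_nonneg _) (by positivity))
    (fun a => ?_) ((hasSum_one_div_pow hp).summable.mul_left (1 / ((p : ℝ) - 1)))
  rw [mul_one_div]
  gcongr
  exact logAbundancy_prime_pow_le hp a

lemma hasSum_logAbundancy_prime_pow {p : ℕ} (hp : p.Prime) :
    HasSum (fun a : ℕ => logAbundancy (p ^ a) / (p : ℝ) ^ a) (W p / (1 - 1 / (p : ℝ))) := by
  have hs := summable_logAbundancy_prime_pow hp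
  have h0 : logAbundancy 1 = 0 := by simp [logAbundancy, sigma1]
  have hW : W p / (1 - 1 / (p : ℝ)) = ∑' a : ℕ, logAbundancy (p ^ a) / (p : ℝ) ^ a := by
    rw [hs.tsum_eq_zero_add, W]
    simp only [W_term_eq hp, tsum_mul_left, pow_zero, h0]
    have := (one_sub_inv_pos hp).ne'
    rw [mul_div_cancel_left₀ _ this]
    simp
  rw [hW]
  exact hs.hasSum

lemma W_nonneg {p : ℕ} (hp : p.Prime) : 0 ≤ W p := by
  refine tsum_nonneg fun h => ?_
  rw [W_term_eq hp]
  exact mul_nonneg (one_sub_inv_pos hp).le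
    (div_nonneg (logAbundancy_nonneg _) (by positivity))

lemma W_le {p : ℕ} (hp : p.Prime) : W p ≤ 1 / ((p : ℝ) * (p - 1)) := by
  have h1 := one_lt_cast_prime hp
  have hp0 : (p : ℝ) ≠ 0 := by linarith
  have hp1 : (p : ℝ) - 1 ≠ 0 := by linarith
  have hb : HasSum (fun h : ℕ => (1 / (p : ℝ) ^ 2) * (1 / (p : ℝ) ^ h))
      (1 / ((p : ℝ) * (p - 1))) := by
    refine ((hasSum_one_div_pow hp).mul_left (1 / (p : ℝ) ^ 2)).congr_real (fun _ => rfl) ?_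
    field_simp
  have hle : ∀ h : ℕ, ((1 - 1 / (p : ℝ)) / (p : ℝ) ^ (h + 1)) *
      Real.log ((1 - 1 / (p : ℝ) ^ (h + 2)) / (1 - 1 / (p : ℝ)))
      ≤ (1 / (p : ℝ) ^ 2) * (1 / (p : ℝ) ^ h) := by
    intro h
    rw [W_term_eq hp]
    calc (1 - 1 / (p : ℝ)) * (logAbundancy (p ^ (h + 1)) / (p : ℝ) ^ (h + 1))
        ≤ (1 - 1 / (p : ℝ)) * ((1 / ((p : ℝ) - 1)) / (p : ℝ) ^ (h + 1)) := by
          have := (one_sub_inv_pos hp).le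
          have := logAbundancy_prime_pow_le hp (h + 1)
          gcongr
      _ = (1 / (p : ℝ) ^ 2) * (1 / (p : ℝ) ^ h) := by
          field_simp
          ring
  rw [← hb.tsum_eq]
  refine Summable.tsum_le_tsum hle (Summable.of_nonneg_of_le (fun h => ?_) hle hb.summable)
    hb.summable
  rw [W_term_eq hp]
  exact mul_nonneg (one_sub_inv_pos hp).le
    (div_nonneg (logAbundancy_nonneg _) (by positivity))

lemma sum_one_div_mul_pred_le (N : ℕ) :
    ∑ p ∈ Nat.primesBelow N, 1 / ((p : ℝ) * (p - 1)) ≤ 1 := by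
  have key : ∀ n : ℕ, ∑ p ∈ Nat.primesBelow (n + 2), 1 / ((p : ℝ) * (p - 1))
      ≤ 1 - 1 / ((n : ℝ) + 1) := by
    intro n
    induction n with
    | zero =>
      have : Nat.primesBelow 2 = ∅ := by decide
      simp [this]
    | succ n ih =>
      have hstep : (1 : ℝ) / (((n + 2 : ℕ) : ℝ) * ((n + 2 : ℕ) - 1))
          = 1 / ((n : ℝ) + 1) - 1 / (((n + 1 : ℕ) : ℝ) + 1) := by
        push_cast
        have h1 : (n : ℝ) + 1 ≠ 0 := by positivity
        have h2 : (n : ℝ) + 1 + 1 ≠ 0 := by positivity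
        have h3 : (n : ℝ) + 2 ≠ 0 := by positivity
        have h4 : (n : ℝ) + 2 - 1 ≠ 0 := by
          have : (n : ℝ) + 2 - 1 = n + 1 := by ring
          rwa [this]
        field_simp
        ring
      by_cases hp : (n + 2).Prime
      · rw [show n + 1 + 2 = (n + 2) + 1 by ring, primesBelow_succ_of_prime hp,
          Finset.sum_insert (notMem_primesBelow_self _), hstep]
        linarith
      · rw [show n + 1 + 2 = (n + 2) + 1 by ring, primesBelow_succ_of_not_prime hp]
        have : (0 : ℝ) ≤ 1 / (((n + 2 : ℕ) : ℝ) * ((n + 2 : ℕ) - 1)) := by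
          push_cast
          have : (0 : ℝ) ≤ (n : ℝ) + 2 - 1 := by linarith [(Nat.cast_nonneg n : (0 : ℝ) ≤ n)]
          positivity
        linarith
  have hmono : Nat.primesBelow N ⊆ Nat.primesBelow (N + 2) := fun p hp => by
    rw [Nat.mem_primesBelow] at hp ⊢
    exact ⟨by omega, hp.2⟩
  refine (Finset.sum_le_sum_of_subset_of_nonneg hmono fun p hp _ => ?_).trans
    ((key N).trans ?_)
  · have := one_lt_cast_prime (Nat.mem_primesBelow.1 hp).2
    have : (0 : ℝ) ≤ (p : ℝ) - 1 := by linarith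
    positivity
  · have : (0 : ℝ) ≤ 1 / ((N : ℝ) + 1) := by positivity
    linarith

lemma practical_one : Practical 1 :=
  ⟨one_pos, fun m h0 h1 => ⟨{1}, by simp, by simp; omega⟩⟩

lemma openPractical_zero : openPractical 0 = {1} := by
  ext m
  simp only [openPractical, smoothBelow_zero, Set.mem_ofPred_eq, Set.mem_singleton_iff]
  exact ⟨fun h => h.1, fun h => ⟨h, h ▸ practical_one, Nat.zero_le _⟩⟩

lemma hasSum_indicator_one (u : ℕ → ℝ) :
    HasSum ((({1} : Set ℕ)).indicator u) (u 1) := by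
  have := hasSum_single (f := (({1} : Set ℕ)).indicator u) 1 fun m hm => by simp [hm]
  simpa using this

/-- The weight `(1/m) ∏_{p ≤ σ(m) + 1} (1 - 1/p)`. -/
noncomputable def weight (m : ℕ) : ℝ := mertens (sigma1 m + 2) / m

lemma weight_nonneg (m : ℕ) : 0 ≤ weight m := div_nonneg (mertens_pos _).le (Nat.cast_nonneg m)

lemma sum_weight_mul_practicalAt (N : ℕ) (F : ℕ → ℝ) :
    ∑ m ∈ practicalAt N, weight m * F m = mertens (N + 1) * ∑ m ∈ practicalAt N, F m / m := by
  rw [Finset.mul_sum]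
  refine Finset.sum_congr rfl fun m hm => ?_
  rw [weight, show sigma1 m + 2 = N + 1 by rw [← (mem_practicalAt.1 hm).2]]
  ring

/-- One minus the total weight of the practical numbers `m` with `σ(m) + 1 < N`. -/
noncomputable def remainder (N : ℕ) : ℝ := 1 - ∑ m ∈ practicalBelow N, weight m

lemma practicalBelow_zero : practicalBelow 0 = ∅ := by simp [practicalBelow]

lemma remainder_succ (N : ℕ) :
    remainder (N + 1) = remainder N - ∑ m ∈ practicalAt N, weight m := by
  rw [remainder, remainder, sum_practicalBelow_succ]
  ring

lemma hasSum_openPractical_inv (N : ℕ) :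
    HasSum ((openPractical N).indicator fun m => 1 / (m : ℝ)) (remainder N / mertens N) := by
  induction N with
  | zero =>
    have h := hasSum_indicator_one fun m => 1 / (m : ℝ)
    rw [openPractical_zero]
    simpa [remainder, practicalBelow_zero, mertens, Nat.primesBelow_zero] using h
  | succ N ih =>
    have hb := sum_weight_mul_practicalAt N fun _ => 1
    simp only [mul_one] at hb
    have hV := (mertens_pos N).ne'
    by_cases hN : N.Prime
    · have h1 := hasSum_powMulSet (F := fun _ => 1) (α := fun _ => 1) (β := fun _ => 0) hN
        (fun m (hm : m ∈ openPractical N) => hm.1) (by simp) ih ih (hasSum_one_div_pow hN)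
        (hasSum_zero_div_pow N)
      rw [powMulSet_openPractical hN] at h1
      convert hasSum_openPractical_succ h1 using 1
      rw [remainder_succ, hb, mertens_succ_of_prime hN]
      have := (one_sub_inv_pos hN).ne'
      set c := 1 - 1 / (N : ℝ)
      field_simp
      ring
    · rw [openPractical_of_not_prime hN] at ih
      convert hasSum_openPractical_succ ih using 1
      rw [remainder_succ, hb, mertens_succ_of_not_prime hN]
      field_simp

lemma hasSum_openPractical_logAbundancy (N : ℕ) :
    HasSum ((openPractical N).indicator fun m => logAbundancy m / (m : ℝ))
      ((∑ q ∈ Nat.primesBelow N, remainder q * W q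
        - ∑ m ∈ practicalBelow N, weight m * logAbundancy m) / mertens N) := by
  induction N with
  | zero =>
    have h := hasSum_indicator_one fun m => logAbundancy m / (m : ℝ)
    rw [openPractical_zero]
    simpa [practicalBelow_zero, Nat.primesBelow_zero, logAbundancy, sigma1] using h
  | succ N ih =>
    have hb := sum_weight_mul_practicalAt N logAbundancy
    have hV := (mertens_pos N).ne'
    rw [sum_practicalBelow_succ, hb]
    by_cases hN : N.Prime
    · have h1 := hasSum_powMulSet (F := logAbundancy) (α := fun _ => 1)
        (β := fun a => logAbundancy (N ^ a)) hN (fun m (hm : m ∈ openPractical N) => hm.1)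
        (fun a k hk => by rw [logAbundancy_pow_mul a hN hk.1, one_mul])
        ih (hasSum_openPractical_inv N) (hasSum_one_div_pow hN)
        (hasSum_logAbundancy_prime_pow hN)
      rw [powMulSet_openPractical hN] at h1
      convert hasSum_openPractical_succ h1 using 1
      rw [primesBelow_succ_of_prime hN, Finset.sum_insert (notMem_primesBelow_self _),
        mertens_succ_of_prime hN]
      have := (one_sub_inv_pos hN).ne'
      set c := 1 - 1 / (N : ℝ)
      field_simp
      ring
    · rw [openPractical_of_not_prime hN] at ih
      convert hasSum_openPractical_succ ih using 1
      rw [primesBelow_succ_of_not_prime hN, mertens_succ_of_not_prime hN]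
      field_simp
      ring

lemma hasSum_smoothBelow_inv (N : ℕ) :
    HasSum ((smoothBelow N).indicator fun m => 1 / (m : ℝ)) (1 / mertens N) := by
  induction N with
  | zero =>
    have h := hasSum_indicator_one fun m => 1 / (m : ℝ)
    rw [smoothBelow_zero]
    simpa [mertens, Nat.primesBelow_zero] using h
  | succ N ih =>
    by_cases hN : N.Prime
    · have h1 := hasSum_powMulSet (F := fun _ => 1) (α := fun _ => 1) (β := fun _ => 0) hN
        subset_rfl (by simp) ih ih (hasSum_one_div_pow hN) (hasSum_zero_div_pow N)
      rw [powMulSet_smoothBelow hN] at h1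
      convert h1 using 1
      rw [mertens_succ_of_prime hN, zero_mul, add_zero, one_div_mul_one_div]
    · rwa [smoothBelow_succ_of_not_prime hN, mertens_succ_of_not_prime hN]

lemma hasSum_smoothBelow_log (N : ℕ) :
    HasSum ((smoothBelow N).indicator fun m => Real.log m / (m : ℝ))
      ((∑ p ∈ Nat.primesBelow N, Real.log p / ((p : ℝ) - 1)) / mertens N) := by
  induction N with
  | zero =>
    have h := hasSum_indicator_one fun m => Real.log m / (m : ℝ)
    rw [smoothBelow_zero]
    simpa [Nat.primesBelow_zero] using h
  | succ N ih =>
    by_cases hN : N.Prime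
    · have hN1 := one_lt_cast_prime hN
      have hB : HasSum (fun a : ℕ => (a * Real.log N) / (N : ℝ) ^ a)
          (Real.log N * (1 / (N : ℝ) / (1 - 1 / (N : ℝ)) ^ 2)) := by
        have hx : ‖1 / (N : ℝ)‖ < 1 := by
          rw [Real.norm_of_nonneg (by positivity)]
          linarith [one_sub_inv_pos hN]
        refine ((hasSum_coe_mul_geometric_of_norm_lt_one hx).mul_left
          (Real.log N)).congr_real (fun a => ?_) rfl
        rw [one_div, inv_pow]
        ring
      have h1 := hasSum_powMulSet (F := fun m => Real.log m) (α := fun _ => 1)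
        (β := fun a => a * Real.log N) hN subset_rfl
        (fun a k hk => by
          have hk0 : (k : ℝ) ≠ 0 := Nat.cast_ne_zero.2 hk.1.ne'
          push_cast
          rw [Real.log_mul (by positivity) hk0, Real.log_pow]
          ring)
        ih (hasSum_smoothBelow_inv N) (hasSum_one_div_pow hN) hB
      rw [powMulSet_smoothBelow hN] at h1
      convert h1 using 1
      rw [primesBelow_succ_of_prime hN, Finset.sum_insert (notMem_primesBelow_self _),
        mertens_succ_of_prime hN]
      have hV := (mertens_pos N).ne'
      have hc : (N : ℝ) - 1 = N * (1 - 1 / (N : ℝ)) := by field_simp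
      have := (one_sub_inv_pos hN).ne'
      rw [hc]
      set c := 1 - 1 / (N : ℝ)
      field_simp
      ring
    · rwa [smoothBelow_succ_of_not_prime hN, mertens_succ_of_not_prime hN,
        primesBelow_succ_of_not_prime hN]

lemma hasSum_smoothBelow_abundancy (N : ℕ) :
    HasSum ((smoothBelow N).indicator fun m => ((sigma1 m : ℝ) / m) / (m : ℝ))
      ((∏ p ∈ Nat.primesBelow N, 1 / (1 - (1 / (p : ℝ)) ^ 2)) / mertens N) := by
  induction N with
  | zero =>
    have h := hasSum_indicator_one fun m => ((sigma1 m : ℝ) / m) / (m : ℝ)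
    rw [smoothBelow_zero]
    simpa [mertens, Nat.primesBelow_zero, sigma1] using h
  | succ N ih =>
    by_cases hN : N.Prime
    · have hc := one_sub_inv_pos hN
      have hx0 : (0 : ℝ) ≤ 1 / (N : ℝ) := by positivity
      have hc2 : 0 < 1 - (1 / (N : ℝ)) ^ 2 := by nlinarith
      have hA : HasSum (fun a : ℕ => ((sigma1 (N ^ a) : ℝ) / (N ^ a : ℕ)) / (N : ℝ) ^ a)
          (1 / ((1 - (1 / (N : ℝ)) ^ 2) * (1 - 1 / (N : ℝ)))) := by
        have h1 := hasSum_geometric_of_lt_one hx0 (by linarith)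
        have h2 := (hasSum_geometric_of_lt_one (sq_nonneg (1 / (N : ℝ)))
          (by linarith)).mul_left (1 / (N : ℝ))
        refine ((h1.sub h2).mul_left (1 / (1 - 1 / (N : ℝ)))).congr_real (fun a => ?_) ?_
        · rw [abundancy_prime_pow hN, ← pow_mul, mul_comm 2 a, pow_mul]
          simp only [one_div, inv_pow, pow_succ]
          ring
        · set x := 1 / (N : ℝ)
          have h3 := hc.ne'
          have h4 := hc2.ne'
          field_simp
          ring
      have h1 := hasSum_powMulSet (F := fun m => (sigma1 m : ℝ) / m)
        (α := fun a => (sigma1 (N ^ a) : ℝ) / (N ^ a : ℕ)) (β := fun _ => 0) hN subset_rfl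
        (fun a k hk => by rw [abundancy_pow_mul a hN hk, add_zero])
        ih (hasSum_smoothBelow_inv N) hA (hasSum_zero_div_pow N)
      rw [powMulSet_smoothBelow hN] at h1
      convert h1 using 1
      rw [primesBelow_succ_of_prime hN, Finset.prod_insert (notMem_primesBelow_self _),
        mertens_succ_of_prime hN]
      have hV := (mertens_pos N).ne'
      have h3 := hc.ne'
      have h4 := hc2.ne'
      set x := 1 / (N : ℝ)
      field_simp
      ring
    · rwa [smoothBelow_succ_of_not_prime hN, mertens_succ_of_not_prime hN,
        primesBelow_succ_of_not_prime hN]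

lemma prod_one_div_le (N : ℕ) :
    ∏ p ∈ Nat.primesBelow N, 1 / (1 - (1 / (p : ℝ)) ^ 2) ≤ Real.exp 1 := by
  refine le_trans ?_ (Real.exp_le_exp.2 (sum_one_div_mul_pred_le N))
  rw [Real.exp_sum]
  refine Finset.prod_le_prod (fun p hp => ?_) fun p hp => ?_
  · have hp' := (Nat.mem_primesBelow.1 hp).2
    have := one_sub_inv_pos hp'
    have h0 : (0 : ℝ) ≤ 1 / (p : ℝ) := by positivity
    have : 0 < 1 - (1 / (p : ℝ)) ^ 2 := by nlinarith
    positivity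
  · have h1 := one_lt_cast_prime (Nat.mem_primesBelow.1 hp).2
    refine le_trans ?_ (Real.add_one_le_exp _)
    have hp0 : (0 : ℝ) < p := by linarith
    have hp1 : (0 : ℝ) < (p : ℝ) - 1 := by linarith
    have hp2 : (0 : ℝ) < (p : ℝ) ^ 2 - 1 := by nlinarith
    have e1 : 1 / (1 - (1 / (p : ℝ)) ^ 2) = 1 / ((p : ℝ) ^ 2 - 1) + 1 := by
      have : 1 - (1 / (p : ℝ)) ^ 2 = ((p : ℝ) ^ 2 - 1) / p ^ 2 := by field_simp
      rw [this]
      field_simp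
      ring
    rw [e1]
    gcongr
    nlinarith

lemma pow_div_dvd_factorial {p : ℕ} (hp : p.Prime) (n : ℕ) : p ^ (n / p) ∣ n.factorial := by
  rw [hp.pow_dvd_iff_le_factorization n.factorial_ne_zero,
    Nat.factorization_factorial hp (b := Nat.log p n + 2) (by omega)]
  have := Finset.single_le_sum (f := fun i => n / p ^ i) (s := Finset.Ico 1 (Nat.log p n + 2))
    (fun _ _ => Nat.zero_le _) (Finset.mem_Ico.2 ⟨le_rfl, by omega⟩ : 1 ∈ _)
  simpa using this

lemma prod_pow_div_dvd_factorial (n : ℕ) (s : Finset ℕ) (hs : ∀ p ∈ s, p.Prime) :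
    ∏ p ∈ s, p ^ (n / p) ∣ n.factorial := by
  induction s using Finset.induction_on with
  | empty => simp
  | insert p s hps ih =>
    rw [Finset.prod_insert hps]
    have hp := hs p (Finset.mem_insert_self p s)
    refine Nat.Coprime.mul_dvd_of_dvd_of_dvd (Nat.Coprime.prod_right fun q hq => ?_)
      (pow_div_dvd_factorial hp n) (ih fun q hq => hs q (Finset.mem_insert_of_mem hq))
    refine Nat.Coprime.pow _ _ ((Nat.coprime_primes hp
      (hs q (Finset.mem_insert_of_mem hq))).2 ?_)
    rintro rfl
    exact hps hq

lemma sum_log_div_le {N : ℕ} (hN : 0 < N) :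
    ∑ p ∈ Nat.primesBelow N, Real.log p / p ≤ 2 * Real.log N := by
  have hN' : (0 : ℝ) < N := by exact_mod_cast hN
  have h1 : ∑ p ∈ Nat.primesBelow N, ((N / p : ℕ) : ℝ) * Real.log p ≤ N * Real.log N := by
    have h2 : ∏ p ∈ Nat.primesBelow N, p ^ (N / p) ≤ N ^ N :=
      (Nat.le_of_dvd (Nat.factorial_pos N) (prod_pow_div_dvd_factorial N _
        fun p hp => (Nat.mem_primesBelow.1 hp).2)).trans (Nat.factorial_le_pow N)
    have h3 : (∏ p ∈ Nat.primesBelow N, (p : ℝ) ^ (N / p)) ≤ (N : ℝ) ^ N := by exact_mod_cast h2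
    have hpos : ∀ p ∈ Nat.primesBelow N, 0 < (p : ℝ) ^ (N / p) := fun p hp =>
      pow_pos (by exact_mod_cast (Nat.mem_primesBelow.1 hp).2.pos) _
    have h4 := Real.log_le_log (Finset.prod_pos hpos) h3
    rw [Real.log_prod fun p hp => (hpos p hp).ne', Real.log_pow] at h4
    simpa only [Real.log_pow] using h4
  have h5 : ∀ p ∈ Nat.primesBelow N,
      (N : ℝ) * (Real.log p / p) ≤ 2 * (((N / p : ℕ) : ℝ) * Real.log p) := by
    intro p hp
    obtain ⟨hlt, hp⟩ := Nat.mem_primesBelow.1 hp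
    have hp1 := one_lt_cast_prime hp
    have hp0 : (0 : ℝ) < p := by linarith
    have h6 : 1 ≤ N / p := (Nat.one_le_div_iff hp.pos).2 hlt.le
    have h7 : N ≤ 2 * (N / p) * p := by
      have := Nat.div_add_mod N p
      have := Nat.mod_lt N hp.pos
      nlinarith
    have h8 : (N : ℝ) ≤ 2 * ((N / p : ℕ) : ℝ) * p := by exact_mod_cast h7
    have h9 := Real.log_nonneg hp1.le
    have h10 : (N : ℝ) / p ≤ 2 * ((N / p : ℕ) : ℝ) := by rwa [div_le_iff₀ hp0]
    calc (N : ℝ) * (Real.log p / p) = (N : ℝ) / p * Real.log p := by ring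
      _ ≤ 2 * ((N / p : ℕ) : ℝ) * Real.log p := by gcongr
      _ = _ := by ring
  have h6 := Finset.sum_le_sum h5
  rw [← Finset.mul_sum, ← Finset.mul_sum] at h6
  have h7 : (N : ℝ) * ∑ p ∈ Nat.primesBelow N, Real.log p / p ≤ N * (2 * Real.log N) := by
    linarith
  exact le_of_mul_le_mul_left h7 hN'

lemma sum_log_div_pred_le {N : ℕ} (hN : 0 < N) :
    ∑ p ∈ Nat.primesBelow N, Real.log p / ((p : ℝ) - 1) ≤ 4 * Real.log N := by
  have h1 : ∑ p ∈ Nat.primesBelow N, Real.log p / ((p : ℝ) - 1)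
      ≤ ∑ p ∈ Nat.primesBelow N, 2 * (Real.log p / p) := by
    refine Finset.sum_le_sum fun p hp => ?_
    have hp' := (Nat.mem_primesBelow.1 hp).2
    have hp2 : (2 : ℝ) ≤ p := by exact_mod_cast hp'.two_le
    have h9 := Real.log_nonneg (one_lt_cast_prime hp').le
    rw [← mul_div_assoc, div_le_div_iff₀ (by linarith) (by linarith)]
    nlinarith
  rw [← Finset.mul_sum] at h1
  linarith [sum_log_div_le hN]

lemma primesBelow_mono {M N : ℕ} (h : M ≤ N) : Nat.primesBelow M ⊆ Nat.primesBelow N :=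
  fun p hp => by
    rw [Nat.mem_primesBelow] at hp ⊢
    exact ⟨by omega, hp.2⟩

lemma mertens_antitone : Antitone mertens := by
  intro M N h
  have hsplit := Finset.prod_sdiff (f := fun p : ℕ => 1 - 1 / (p : ℝ)) (primesBelow_mono h)
  rw [mertens, ← hsplit]
  refine mul_le_of_le_one_left (mertens_pos M).le (Finset.prod_le_one (fun p hp => ?_) ?_)
  · exact (one_sub_inv_pos (Nat.mem_primesBelow.1 (Finset.mem_sdiff.1 hp).1).2).le
  · intro p _
    have : (0 : ℝ) ≤ 1 / p := by positivity
    linarith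

lemma mertens_le_exp_mul {M N : ℕ} (hM : 2 ≤ M) (h : M ≤ N) :
    mertens M ≤ Real.exp (4 * (Real.log N / Real.log M)) * mertens N := by
  have hlogM : 0 < Real.log M := Real.log_pos (by exact_mod_cast hM)
  have hsplit : mertens N
      = (∏ p ∈ Nat.primesBelow N \ Nat.primesBelow M, (1 - 1 / (p : ℝ))) * mertens M :=
    (Finset.prod_sdiff (primesBelow_mono h)).symm
  have hsum : ∑ p ∈ Nat.primesBelow N \ Nat.primesBelow M, 2 / (p : ℝ)
      ≤ 4 * (Real.log N / Real.log M) := by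
    have h1 : ∑ p ∈ Nat.primesBelow N \ Nat.primesBelow M, 2 / (p : ℝ)
        ≤ ∑ p ∈ Nat.primesBelow N \ Nat.primesBelow M,
          (2 / Real.log M) * (Real.log p / p) := by
      refine Finset.sum_le_sum fun p hp => ?_
      obtain ⟨hpN, hpM⟩ := Finset.mem_sdiff.1 hp
      have hpr := (Nat.mem_primesBelow.1 hpN).2
      have hMp : M ≤ p := by
        by_contra! hlt
        exact hpM (Nat.mem_primesBelow.2 ⟨hlt, hpr⟩)
      have hlog : Real.log M ≤ Real.log p :=
        Real.log_le_log (by exact_mod_cast (by omega : 0 < M)) (by exact_mod_cast hMp)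
      have hp0 : (0 : ℝ) < p := by exact_mod_cast hpr.pos
      rw [div_mul_div_comm, div_le_div_iff₀ hp0 (by positivity)]
      nlinarith [mul_le_mul_of_nonneg_right hlog hp0.le]
    have h2 : ∑ p ∈ Nat.primesBelow N \ Nat.primesBelow M, Real.log p / p
        ≤ ∑ p ∈ Nat.primesBelow N, Real.log p / p := by
      refine Finset.sum_le_sum_of_subset_of_nonneg Finset.sdiff_subset fun p hp _ => ?_
      have := Real.log_nonneg (one_lt_cast_prime (Nat.mem_primesBelow.1 hp).2).le
      positivity
    have h3 := h2.trans (sum_log_div_le (by omega : 0 < N))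
    rw [← Finset.mul_sum] at h1
    calc _ ≤ _ := h1
      _ ≤ (2 / Real.log M) * (2 * Real.log N) := by gcongr
      _ = _ := by ring
  have hprod : Real.exp (-∑ p ∈ Nat.primesBelow N \ Nat.primesBelow M, 2 / (p : ℝ))
      ≤ ∏ p ∈ Nat.primesBelow N \ Nat.primesBelow M, (1 - 1 / (p : ℝ)) := by
    rw [← Finset.sum_neg_distrib, Real.exp_sum]
    refine Finset.prod_le_prod (fun _ _ => (Real.exp_pos _).le) fun p hp => ?_
    have hpr := (Nat.mem_primesBelow.1 (Finset.mem_sdiff.1 hp).1).2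
    have hp2 : (2 : ℝ) ≤ p := by exact_mod_cast hpr.two_le
    have hc := one_sub_inv_pos hpr
    rw [Real.exp_neg, inv_le_comm₀ (Real.exp_pos _) hc]
    refine le_trans ?_ (Real.add_one_le_exp _)
    have : 1 - 1 / (p : ℝ) = (p - 1) / p := by field_simp
    have hp1 : (0 : ℝ) < p - 1 := by linarith
    have hp0 : (0 : ℝ) < p := by linarith
    have e : 2 / (p : ℝ) + 1 = (p + 2) / p := by field_simp; ring
    rw [this, inv_div, e, div_le_div_iff₀ hp1 hp0]
    nlinarith
  have hM0 := mertens_pos M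
  calc mertens M = Real.exp (4 * (Real.log N / Real.log M))
        * (Real.exp (-(4 * (Real.log N / Real.log M))) * mertens M) := by
        rw [← mul_assoc, ← Real.exp_add, add_neg_cancel, Real.exp_zero, one_mul]
    _ ≤ Real.exp (4 * (Real.log N / Real.log M))
        * ((∏ p ∈ Nat.primesBelow N \ Nat.primesBelow M, (1 - 1 / (p : ℝ))) * mertens M) := by
        gcongr
        exact (Real.exp_le_exp.2 (neg_le_neg hsum)).trans hprod
    _ = _ := by rw [← hsplit]

lemma sigma1_le_sq (m : ℕ) : sigma1 m ≤ m ^ 2 := by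
  have h := Finset.sum_le_card_nsmul m.divisors (fun d => d) m fun d hd => Nat.divisor_le hd
  have hc : m.divisors.card ≤ m := Nat.card_divisors_le_self m
  calc sigma1 m ≤ m.divisors.card * m := by simpa [sigma1] using h
    _ ≤ m * m := Nat.mul_le_mul_right m hc
    _ = m ^ 2 := (sq m).symm

lemma remainder_nonneg (N : ℕ) : 0 ≤ remainder N := by
  have h := (hasSum_openPractical_inv N).nonneg fun m =>
    Set.indicator_nonneg (fun m _ => by positivity) m
  have hV := mertens_pos N
  rwa [le_div_iff₀ hV, zero_mul] at h

lemma remainder_antitone : Antitone remainder :=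
  antitone_nat_of_succ_le fun N => by
    rw [remainder_succ]
    have := Finset.sum_nonneg fun m (_ : m ∈ practicalAt N) => weight_nonneg m
    linarith

lemma remainder_sub_le {N c : ℕ} (hN : 2 ≤ N) (hc : 0 < c) :
    remainder N - 4 / c
      ≤ Real.exp (4 * (2 * c + 2 : ℕ)) * (remainder N - remainder (N ^ (2 * c + 2))) := by
  set N' := N ^ (2 * c + 2) with hN'
  have hNN' : N ≤ N' := Nat.le_self_pow (by omega) N
  have hlogN : 0 < Real.log N := Real.log_pos (by exact_mod_cast hN)
  have hc0 : (0 : ℝ) < c := by exact_mod_cast hc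
  set D := practicalBelow N' \ practicalBelow N with hD
  have hsub : practicalBelow N ⊆ practicalBelow N' := fun m hm => by
    rw [mem_practicalBelow] at hm ⊢
    exact ⟨hm.1, by omega⟩
  have hdiff : remainder N - remainder N' = ∑ m ∈ D, weight m := by
    rw [remainder, remainder, ← Finset.sum_sdiff hsub]
    ring
  have hDle : mertens N' * ∑ m ∈ D, 1 / (m : ℝ) ≤ ∑ m ∈ D, weight m := by
    rw [Finset.mul_sum]
    refine Finset.sum_le_sum fun m hm => ?_
    have hm' := (mem_practicalBelow.1 (Finset.mem_sdiff.1 hm).1).2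
    rw [mul_one_div, weight]
    gcongr
    exact mertens_antitone (by omega)
  have hsumD : HasSum ((↑D : Set ℕ).indicator fun m => 1 / (m : ℝ)) (∑ m ∈ D, 1 / (m : ℝ)) :=
    hasSum_subtype_iff_indicator.1 (D.hasSum fun m => 1 / (m : ℝ))
  have hle := hasSum_le (fun m => ?_) (hasSum_openPractical_inv N)
    (hsumD.add ((hasSum_smoothBelow_log N).mul_left (1 / (c * Real.log N))))
  · have hV := mertens_pos N
    have hV' := mertens_pos N'
    have h1 := sum_log_div_pred_le (by omega : 0 < N)
    have h2 : remainder N ≤ mertens N * ∑ m ∈ D, 1 / (m : ℝ) + 4 / c := by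
      rw [div_le_iff₀ hV] at hle
      have e : (1 / (c * Real.log N)) * (4 * Real.log N) = 4 / (c : ℝ) := by field_simp
      rw [← e]
      calc _ ≤ _ := hle
        _ = mertens N * ∑ m ∈ D, 1 / (m : ℝ) + (1 / (c * Real.log N)) *
            ∑ p ∈ Nat.primesBelow N, Real.log p / ((p : ℝ) - 1) := by
            field_simp
        _ ≤ _ := by gcongr
    have h3 : mertens N ≤ Real.exp (4 * (2 * c + 2 : ℕ)) * mertens N' := by
      have h4 := mertens_le_exp_mul hN hNN'
      rwa [hN', Nat.cast_pow, Real.log_pow, mul_div_assoc, div_self hlogN.ne', mul_one] at h4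
    have hD0 : 0 ≤ ∑ m ∈ D, 1 / (m : ℝ) := Finset.sum_nonneg fun m _ => by positivity
    calc remainder N - 4 / c ≤ mertens N * ∑ m ∈ D, 1 / (m : ℝ) := by linarith
      _ ≤ (Real.exp (4 * (2 * c + 2 : ℕ)) * mertens N') * ∑ m ∈ D, 1 / (m : ℝ) := by gcongr
      _ = Real.exp (4 * (2 * c + 2 : ℕ)) * (mertens N' * ∑ m ∈ D, 1 / (m : ℝ)) := by ring
      _ ≤ _ := by
        rw [hdiff]
        gcongr
  · have hlogm : 0 ≤ Real.log m := Real.log_natCast_nonneg m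
    have hS0 : 0 ≤ (smoothBelow N).indicator (fun m => Real.log m / (m : ℝ)) m :=
      Set.indicator_nonneg (fun m _ => div_nonneg (Real.log_natCast_nonneg m) (by positivity)) m
    have hD0 : 0 ≤ (↑D : Set ℕ).indicator (fun m => 1 / (m : ℝ)) m :=
      Set.indicator_nonneg (fun m _ => by positivity) m
    have hk : 0 ≤ 1 / (c * Real.log N) := by positivity
    have hkS := mul_nonneg hk hS0
    by_cases hA : m ∈ openPractical N
    · rw [Set.indicator_of_mem hA]
      obtain ⟨hS, hpr, hge⟩ := hA
      rcases le_or_gt m (N ^ c) with hm | hm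
      · have hmD : m ∈ (↑D : Set ℕ) := by
          have h1 := sigma1_le_sq m
          have h2 : m ^ 2 ≤ (N ^ c) ^ 2 := Nat.pow_le_pow_left hm 2
          have h3 : N' = (N ^ c) ^ 2 * N ^ 2 := by rw [hN']; ring
          have h4 : 2 ^ 2 ≤ N ^ 2 := Nat.pow_le_pow_left hN 2
          have h5 : 0 < (N ^ c) ^ 2 := by positivity
          have h6 : sigma1 m + 1 < N' := by nlinarith
          simp only [hD, Finset.coe_sdiff, Set.mem_sdiff, Finset.mem_coe, mem_practicalBelow,
            not_and, not_lt]
          exact ⟨⟨hpr, h6⟩, fun _ => hge⟩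
        rw [Set.indicator_of_mem hmD]
        linarith
      · rw [Set.indicator_of_mem hS]
        have hm0 : (0 : ℝ) < m := by exact_mod_cast hpr.1
        have h1 : c * Real.log N ≤ Real.log m := by
          rw [← Real.log_pow]
          refine Real.log_le_log (by positivity) ?_
          exact_mod_cast hm.le
        have h2 : 1 / (m : ℝ) ≤ 1 / (c * Real.log N) * (Real.log m / m) := by
          rw [div_mul_div_comm, one_mul, div_le_div_iff₀ hm0 (by positivity), one_mul]
          exact mul_le_mul_of_nonneg_right h1 hm0.le
        linarith
    · rw [Set.indicator_of_notMem hA]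
      linarith

lemma tendsto_remainder : Tendsto remainder atTop (𝓝 0) := by
  have hbdd : BddBelow (Set.range remainder) :=
    ⟨0, by rintro _ ⟨N, rfl⟩; exact remainder_nonneg N⟩
  have hlim := tendsto_atTop_ciInf remainder_antitone hbdd
  set l := ⨅ N, remainder N
  have hl0 : 0 ≤ l := ge_of_tendsto' hlim remainder_nonneg
  have hl : ∀ c : ℕ, 0 < c → l ≤ 4 / c := by
    intro c hc
    have hpow : Tendsto (fun N : ℕ => N ^ (2 * c + 2)) atTop atTop :=
      tendsto_pow_atTop (by omega)
    have h1 : Tendsto (fun N => remainder N - 4 / (c : ℝ)) atTop (𝓝 (l - 4 / c)) :=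
      hlim.sub_const _
    have h2 := (hlim.sub (hlim.comp hpow)).const_mul (Real.exp (4 * (2 * c + 2 : ℕ)))
    rw [sub_self, mul_zero] at h2
    have h3 := le_of_tendsto_of_tendsto h1 h2 (by
      filter_upwards [eventually_ge_atTop 2] with N hN
      exact remainder_sub_le hN hc)
    linarith
  have hle : l ≤ 0 := by
    have h4 : Tendsto (fun c : ℕ => 4 / (c : ℝ)) atTop (𝓝 0) :=
      tendsto_const_div_atTop_nhds_zero_nat 4
    refine ge_of_tendsto h4 ?_
    filter_upwards [eventually_gt_atTop 0] with c hc
    exact hl c hc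
  rwa [le_antisymm hle hl0] at hlim

/-- The sum of `W q` over the primes `q < N`. -/
noncomputable def sumW (N : ℕ) : ℝ := ∑ q ∈ Nat.primesBelow N, W q

lemma sumW_nonneg (N : ℕ) : 0 ≤ sumW N :=
  Finset.sum_nonneg fun _ hq => W_nonneg (Nat.mem_primesBelow.1 hq).2

lemma sumW_le_one (N : ℕ) : sumW N ≤ 1 :=
  (Finset.sum_le_sum fun _ hq => W_le (Nat.mem_primesBelow.1 hq).2).trans
    (sum_one_div_mul_pred_le N)

/-- The mean of `log (σ(m) / m)` over the set `openPractical N`. -/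
noncomputable def logRemainder (N : ℕ) : ℝ :=
  ∑ q ∈ Nat.primesBelow N, remainder q * W q
    - ∑ m ∈ practicalBelow N, weight m * logAbundancy m

lemma sum_remainder_mul_W (N : ℕ) :
    ∑ q ∈ Nat.primesBelow N, remainder q * W q
      = remainder N * sumW N + ∑ m ∈ practicalBelow N, weight m * sumW (sigma1 m + 2) := by
  induction N with
  | zero => simp [sumW, practicalBelow_zero, Nat.primesBelow_zero]
  | succ N ih =>
    have hb : ∑ m ∈ practicalAt N, weight m * sumW (sigma1 m + 2)
        = (∑ m ∈ practicalAt N, weight m) * sumW (N + 1) := by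
      rw [Finset.sum_mul]
      refine Finset.sum_congr rfl fun m hm => ?_
      rw [show sigma1 m + 2 = N + 1 by rw [← (mem_practicalAt.1 hm).2]]
    rw [sum_practicalBelow_succ, hb, remainder_succ]
    by_cases hN : N.Prime
    · have hW : sumW (N + 1) = W N + sumW N := by
        rw [sumW, primesBelow_succ_of_prime hN, Finset.sum_insert (notMem_primesBelow_self _)]
        rfl
      rw [hW, primesBelow_succ_of_prime hN, Finset.sum_insert (notMem_primesBelow_self _), ih]
      ring
    · have hW : sumW (N + 1) = sumW N := by
        rw [sumW, primesBelow_succ_of_not_prime hN]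
        rfl
      rw [hW, primesBelow_succ_of_not_prime hN, ih]
      ring

lemma logRemainder_nonneg (N : ℕ) : 0 ≤ logRemainder N := by
  have h := (hasSum_openPractical_logAbundancy N).nonneg fun m =>
    Set.indicator_nonneg (fun m _ => div_nonneg (logAbundancy_nonneg m) (by positivity)) m
  have hV := mertens_pos N
  rwa [le_div_iff₀ hV, zero_mul] at h

lemma log_le_add_exp_neg_mul {x : ℝ} (hx : 0 < x) (K : ℝ) :
    Real.log x ≤ K + Real.exp (-K) * x := by
  have h := Real.log_le_sub_one_of_pos (mul_pos (Real.exp_pos (-K)) hx)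
  rw [Real.log_mul (Real.exp_pos _).ne' hx.ne', Real.log_exp] at h
  linarith

lemma logRemainder_le (N : ℕ) (K : ℝ) :
    logRemainder N ≤ K * remainder N + Real.exp (1 - K) := by
  have hV := mertens_pos N
  have hle := hasSum_le (fun m => ?_) (hasSum_openPractical_logAbundancy N)
    (((hasSum_openPractical_inv N).mul_left K).add
      ((hasSum_smoothBelow_abundancy N).mul_left (Real.exp (-K))))
  · rw [div_le_iff₀ hV] at hle
    calc logRemainder N ≤ _ := hle
      _ = K * remainder N
          + Real.exp (-K) * ∏ p ∈ Nat.primesBelow N, 1 / (1 - (1 / (p : ℝ)) ^ 2) := by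
        field_simp
      _ ≤ K * remainder N + Real.exp (-K) * Real.exp 1 := by
        gcongr
        exact prod_one_div_le N
      _ = _ := by
        rw [← Real.exp_add]
        ring_nf
  · by_cases hA : m ∈ openPractical N
    · rw [Set.indicator_of_mem hA, Set.indicator_of_mem hA, Set.indicator_of_mem hA.1]
      have hm0 : (0 : ℝ) < m := by exact_mod_cast hA.1.1
      have h := log_le_add_exp_neg_mul (abundancy_pos hA.1.1) K
      rw [← mul_div_assoc, ← mul_div_assoc, mul_one, ← add_div]
      exact div_le_div_of_nonneg_right h hm0.le
    · rw [Set.indicator_of_notMem hA, Set.indicator_of_notMem hA, mul_zero, zero_add]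
      exact mul_nonneg (Real.exp_pos _).le
        (Set.indicator_nonneg (fun m _ => by positivity) m)

lemma tendsto_logRemainder : Tendsto logRemainder atTop (𝓝 0) := by
  rw [tendsto_order]
  refine ⟨fun a ha => Eventually.of_forall fun N => ha.trans_le (logRemainder_nonneg N),
    fun ε hε => ?_⟩
  have hK : Real.exp (1 - (1 - Real.log (ε / 2))) = ε / 2 := by
    rw [sub_sub_cancel, Real.exp_log (by linarith)]
  have h := tendsto_remainder.const_mul (1 - Real.log (ε / 2))
  rw [mul_zero] at h
  filter_upwards [h.eventually_lt_const (half_pos hε)] with N hN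
  have := logRemainder_le N (1 - Real.log (ε / 2))
  linarith

/-- The integers `m < N` that are not practical or satisfy `σ(m) + 1 < N`. -/
noncomputable def cutoff (N : ℕ) : Finset ℕ :=
  (Finset.range N).filter fun m => ¬ Practical m ∨ sigma1 m + 1 < N

lemma tendsto_cutoff : Tendsto cutoff atTop atTop := by
  refine tendsto_atTop_finset_of_monotone (fun M N h m hm => ?_) fun m => ?_
  · simp only [cutoff, Finset.mem_filter, Finset.mem_range] at hm ⊢
    exact ⟨by omega, hm.2.imp id fun h' => by omega⟩
  · refine ⟨m + sigma1 m + 2, Finset.mem_filter.2 ⟨Finset.mem_range.2 (by omega), Or.inr ?_⟩⟩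
    omega

lemma sum_cutoff (N : ℕ) (g : ℕ → ℝ) :
    ∑ m ∈ cutoff N, (if Practical m then g m else 0) = ∑ m ∈ practicalBelow N, g m := by
  rw [← Finset.sum_filter]
  refine Finset.sum_congr ?_ fun _ _ => rfl
  ext m
  simp only [cutoff, practicalBelow, Finset.mem_filter]
  tauto

lemma summable_practical {g : ℕ → ℝ} (hg : ∀ m, 0 ≤ g m) {C : ℝ}
    (h : ∀ N, ∑ m ∈ practicalBelow N, g m ≤ C) :
    Summable fun m => if Practical m then g m else 0 := by
  have h0 : ∀ m, 0 ≤ if Practical m then g m else 0 := fun m => by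
    split_ifs
    exacts [hg m, le_rfl]
  refine summable_of_sum_le h0 (c := C) fun u => ?_
  obtain ⟨N, hN⟩ := (tendsto_cutoff.eventually_ge_atTop u).exists
  refine (Finset.sum_le_sum_of_subset_of_nonneg hN fun m _ _ => h0 m).trans ?_
  rw [sum_cutoff]
  exact h N

lemma summable_weight_mul_logAbundancy :
    Summable fun m => if Practical m then weight m * logAbundancy m else 0 := by
  refine summable_practical (fun m => mul_nonneg (weight_nonneg m) (logAbundancy_nonneg m))
    (C := 1) fun N => ?_
  have h1 := logRemainder_nonneg N
  have h2 : ∑ q ∈ Nat.primesBelow N, remainder q * W q ≤ sumW N := by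
    refine Finset.sum_le_sum fun q hq => ?_
    refine mul_le_of_le_one_left (W_nonneg (Nat.mem_primesBelow.1 hq).2) ?_
    have := Finset.sum_nonneg fun m (_ : m ∈ practicalBelow q) => weight_nonneg m
    rw [remainder]
    linarith
  have h3 := sumW_le_one N
  rw [logRemainder] at h1
  linarith

lemma summable_weight_mul_sumW :
    Summable fun m => if Practical m then weight m * sumW (sigma1 m + 2) else 0 := by
  refine summable_practical (fun m => mul_nonneg (weight_nonneg m) (sumW_nonneg _))
    (C := 1) fun N => ?_
  have h1 := remainder_nonneg N
  have h2 : ∑ m ∈ practicalBelow N, weight m * sumW (sigma1 m + 2)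
      ≤ ∑ m ∈ practicalBelow N, weight m :=
    Finset.sum_le_sum fun m _ => mul_le_of_le_one_right (weight_nonneg m) (sumW_le_one _)
  rw [remainder] at h1
  linarith

lemma tsum_weight_mul_logAbundancy :
    ∑' m, (if Practical m then weight m * logAbundancy m else 0)
      = ∑' m, (if Practical m then weight m * sumW (sigma1 m + 2) else 0) := by
  have h1 := summable_weight_mul_logAbundancy.hasSum.comp tendsto_cutoff
  have h2 := summable_weight_mul_sumW.hasSum.comp tendsto_cutoff
  have h3 : Tendsto (fun N => logRemainder N - remainder N * sumW N) atTop (𝓝 0) := by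
    have h4 : Tendsto (fun N => remainder N * sumW N) atTop (𝓝 0) :=
      squeeze_zero (fun N => mul_nonneg (remainder_nonneg N) (sumW_nonneg N))
        (fun N => mul_le_of_le_one_right (remainder_nonneg N) (sumW_le_one N))
        tendsto_remainder
    simpa using tendsto_logRemainder.sub h4
  have h5 := tendsto_nhds_unique (h2.sub h1) (h3.congr fun N => ?_)
  · linarith
  · simp only [Function.comp_apply, sum_cutoff]
    rw [logRemainder, sum_remainder_mul_W]
    ring

lemma primesUpTo_sigma1 (n : ℕ) :
    primesUpTo ((sigma1 n : ℝ) + 1) = Nat.primesBelow (sigma1 n + 2) := by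
  have h : ⌊(sigma1 n : ℝ) + 1⌋₊ = sigma1 n + 1 := by
    exact_mod_cast Nat.floor_natCast (R := ℝ) (sigma1 n + 1)
  ext p
  simp only [primesUpTo, h, Finset.mem_filter, Finset.mem_Iic, Nat.mem_primesBelow]
  refine and_congr_left fun _ => ?_
  omega

lemma ite_practical_logAbundancy_eq :
    (fun n : ℕ => if Practical n then
        (1 / (n : ℝ)) * Real.log ((sigma1 n : ℝ) / (n : ℝ)) *
          ∏ p ∈ primesUpTo ((sigma1 n : ℝ) + 1), (1 - 1 / (p : ℝ))
      else 0) = fun n => if Practical n then weight n * logAbundancy n else 0 := by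
  funext n
  rw [primesUpTo_sigma1, weight, mertens, logAbundancy]
  congr 1
  ring

lemma ite_practical_sumW_eq :
    (fun n : ℕ => if Practical n then
        (1 / (n : ℝ)) * (∑ q ∈ primesUpTo ((sigma1 n : ℝ) + 1), W q) *
          ∏ p ∈ primesUpTo ((sigma1 n : ℝ) + 1), (1 - 1 / (p : ℝ))
      else 0) = fun n => if Practical n then weight n * sumW (sigma1 n + 2) else 0 := by
  funext n
  rw [primesUpTo_sigma1, weight, mertens, sumW]
  congr 1
  ring

end PracticalSums

theorem lemma3 :
    Summable (fun n : ℕ =>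
      if Practical n then
        (1 / (n : ℝ)) * Real.log ((sigma1 n : ℝ) / (n : ℝ)) *
          ∏ p ∈ primesUpTo ((sigma1 n : ℝ) + 1), (1 - 1 / (p : ℝ))
      else 0) ∧
    Summable (fun n : ℕ =>
      if Practical n then
        (1 / (n : ℝ)) * (∑ q ∈ primesUpTo ((sigma1 n : ℝ) + 1), W q) *
          ∏ p ∈ primesUpTo ((sigma1 n : ℝ) + 1), (1 - 1 / (p : ℝ))
      else 0) ∧
    (∑' n : ℕ,
      if Practical n then
        (1 / (n : ℝ)) * Real.log ((sigma1 n : ℝ) / (n : ℝ)) *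
          ∏ p ∈ primesUpTo ((sigma1 n : ℝ) + 1), (1 - 1 / (p : ℝ))
      else 0)
    = ∑' n : ℕ,
        if Practical n then
          (1 / (n : ℝ)) * (∑ q ∈ primesUpTo ((sigma1 n : ℝ) + 1), W q) *
            ∏ p ∈ primesUpTo ((sigma1 n : ℝ) + 1), (1 - 1 / (p : ℝ))
        else 0 := by
  rw [ite_practical_logAbundancy_eq, ite_practical_sumW_eq]
  exact ⟨summable_weight_mul_logAbundancy, summable_weight_mul_sumW,
    tsum_weight_mul_logAbundancy⟩
end

section
/- For every prime q, the quantity W_q := Σ_{h ≥ 1} ((1 − 1/q)/q^h)·log((1 − 1/q^{h+1})/(1 − 1/q)) satisfies 0 < W_q < 1/(q(q − 1)). -/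
open scoped BigOperators

/-- Each term of `∑ (1 - x) x ^ (h + 1) log ((1 - x ^ (h + 2)) / (1 - x))` is positive and less
than `x ^ (h + 2)`. -/
lemma term_bounds {x : ℝ} (hx0 : 0 < x) (hx1 : x < 1) (h : ℕ) :
    0 < (1 - x) * x ^ (h + 1) * Real.log ((1 - x ^ (h + 2)) / (1 - x)) ∧
      (1 - x) * x ^ (h + 1) * Real.log ((1 - x ^ (h + 2)) / (1 - x)) < x ^ (h + 2) := by
  have h1 : 0 < 1 - x := sub_pos.2 hx1
  have hpow : x ^ (h + 2) < x := pow_lt_self_of_lt_one₀ hx0 hx1 (by omega)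
  have hratio : 1 < (1 - x ^ (h + 2)) / (1 - x) := by
    rw [one_lt_div h1]
    linarith
  have hpos : 0 < (1 - x) * x ^ (h + 1) := by positivity
  refine ⟨mul_pos hpos (Real.log_pos hratio), ?_⟩
  have hlog : Real.log ((1 - x ^ (h + 2)) / (1 - x)) < x / (1 - x) := by
    refine (Real.log_le_sub_one_of_pos (by linarith)).trans_lt ?_
    rw [div_sub_one h1.ne']
    have := pow_pos hx0 (h + 2)
    gcongr
    linarith
  calc (1 - x) * x ^ (h + 1) * Real.log ((1 - x ^ (h + 2)) / (1 - x))
      < (1 - x) * x ^ (h + 1) * (x / (1 - x)) := by gcongr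
    _ = x ^ (h + 2) := by
      field_simp
      ring

theorem W_bounds (q : ℕ) (hq : q.Prime) :
    0 < W q ∧ W q < 1 / ((q : ℝ) * ((q : ℝ) - 1)) := by
  have hq1 : (1 : ℝ) < q := by exact_mod_cast hq.one_lt
  have hq0 : (0 : ℝ) < q := by linarith
  have hx0 : 0 < (q : ℝ)⁻¹ := inv_pos.2 hq0
  have hx1 : (q : ℝ)⁻¹ < 1 := inv_lt_one_of_one_lt₀ hq1
  have hb := term_bounds hx0 hx1
  have hgeom : HasSum (fun h : ℕ => (q : ℝ)⁻¹ ^ (h + 2)) (1 / ((q : ℝ) * ((q : ℝ) - 1))) := by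
    have hsum_eq : 1 / ((q : ℝ) * ((q : ℝ) - 1)) = (1 - (q : ℝ)⁻¹)⁻¹ * (q : ℝ)⁻¹ ^ 2 := by
      have : (q : ℝ) - 1 ≠ 0 := by linarith
      field_simp
    simpa only [hsum_eq, pow_add] using
      (hasSum_geometric_of_lt_one hx0.le hx1).mul_right ((q : ℝ)⁻¹ ^ 2)
  have hsum := Summable.of_nonneg_of_le (fun h => (hb h).1.le) (fun h => (hb h).2.le)
    hgeom.summable
  have hW : W q = ∑' h : ℕ, (1 - (q : ℝ)⁻¹) * (q : ℝ)⁻¹ ^ (h + 1) *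
      Real.log ((1 - (q : ℝ)⁻¹ ^ (h + 2)) / (1 - (q : ℝ)⁻¹)) := by
    simp only [W, div_eq_mul_inv, inv_pow, one_mul]
  rw [hW]
  refine ⟨hsum.tsum_pos (fun h => (hb h).1.le) 0 (hb 0).1, ?_⟩
  rw [← hgeom.tsum_eq]
  exact hsum.tsum_lt_tsum (fun h => (hb h).2.le) (hb 0).2 hgeom.summable
end

section
/- For every real x ≥ 3: 0 < Σ_{p > x} (log p)/(p(p − 1)) < (1 + log x)/x, where the sum is over primes p exceeding x. In particular 0 < δ(x) − η(x) < (1 + log x)/x, where η(x) = Σ_{p ≤ x} (log p)/(p − 1) − log x + γ and δ(x) = η(x) + Σ_{p > x} (log p)/(p(p − 1)). -/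
open scoped BigOperators
open Classical

/-- `η(x) = Σ_{p ≤ x} (log p)/(p − 1) − log x + γ`. -/
noncomputable def eta (x : ℝ) : ℝ :=
  (∑ p ∈ primesUpTo x, Real.log p / ((p : ℝ) - 1)) - Real.log x + Real.eulerMascheroniConstant

/-- `δ(x) = Σ_{p ≤ x} (log p)/p − log x + γ + Σ_{p} (log p)/(p(p − 1))`. -/
noncomputable def delta (x : ℝ) : ℝ :=
  (∑ p ∈ primesUpTo x, Real.log p / (p : ℝ)) - Real.log x + Real.eulerMascheroniConstant
    + ∑' p : ℕ, if p.Prime then Real.log p / ((p : ℝ) * ((p : ℝ) - 1)) else 0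

/-- The function `t ↦ (1 + log t) / t` is strictly decreasing from any point exceeding `1`. -/
lemma one_add_log_div_lt {x y : ℝ} (hx : 1 < x) (hxy : x < y) :
    (1 + Real.log y) / y < (1 + Real.log x) / x := by
  have hx0 : 0 < x := by linarith
  have hy0 : 0 < y := by linarith
  have hlog : 0 < Real.log x := Real.log_pos hx
  have h := Real.log_le_sub_one_of_pos (div_pos hy0 hx0)
  rw [Real.log_div hy0.ne' hx0.ne'] at h
  rw [div_lt_div_iff₀ hy0 hx0]
  have h2 : (Real.log y - Real.log x) * x ≤ y - x := by
    calc (Real.log y - Real.log x) * x ≤ (y / x - 1) * x := by gcongr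
      _ = y - x := by field_simp
  nlinarith

lemma log_div_mul_sub_one_le {t : ℝ} (ht : 4 ≤ t) :
    Real.log t / (t * (t - 1)) ≤
      (1 + Real.log t) / t - (1 + Real.log (t + 2)) / (t + 2) := by
  have ht0 : 0 < t := by linarith
  have hlog : 0 ≤ Real.log t := Real.log_nonneg (by linarith)
  have h := Real.log_le_sub_one_of_pos (div_pos (by linarith : 0 < t + 2) ht0)
  rw [Real.log_div (by linarith) ht0.ne'] at h
  have h2 : Real.log (t + 2) ≤ Real.log t + 2 / t := by
    have : (t + 2) / t - 1 = 2 / t := by field_simp; ring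
    linarith
  calc Real.log t / (t * (t - 1)) ≤ Real.log t * (2 / (t * (t + 2))) := by
        rw [div_eq_mul_inv, ← one_div]
        gcongr ?_ * ?_
        rw [div_le_div_iff₀ (by nlinarith) (by positivity)]
        nlinarith
    _ = (1 + Real.log t) / t - (1 + (Real.log t + 2 / t)) / (t + 2) := by
        field_simp
        ring
    _ ≤ _ := by gcongr

lemma log_div_mul_sub_one_nonneg (n : ℕ) :
    0 ≤ Real.log n / ((n : ℝ) * ((n : ℝ) - 1)) := by
  rcases Nat.eq_zero_or_pos n with rfl | hn
  · simp
  · have : (1 : ℝ) ≤ n := by exact_mod_cast hn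
    exact div_nonneg (Real.log_nonneg this) (mul_nonneg (by linarith) (by linarith))

lemma prime_tail_nonneg (x : ℝ) (n : ℕ) :
    0 ≤ if n.Prime ∧ x < (n : ℝ) then Real.log n / ((n : ℝ) * ((n : ℝ) - 1)) else 0 := by
  split_ifs
  · exact log_div_mul_sub_one_nonneg n
  · exact le_rfl

lemma exists_odd_gt_forall_prime_ge {x : ℝ} (hx : 3 ≤ x) :
    ∃ m : ℕ, Odd m ∧ 4 ≤ m ∧ x < m ∧ ∀ p : ℕ, p.Prime → x < p → m ≤ p := by
  have hfloor : 3 ≤ ⌊x⌋₊ := Nat.le_floor (by exact_mod_cast hx)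
  have hlt : x < (⌊x⌋₊ + 1 : ℕ) := by exact_mod_cast Nat.lt_floor_add_one x
  have hge : ∀ p : ℕ, x < p → ⌊x⌋₊ + 1 ≤ p := fun p hp =>
    (Nat.floor_lt (by linarith)).2 hp
  rcases Nat.even_or_odd (⌊x⌋₊ + 1) with he | ho
  · refine ⟨⌊x⌋₊ + 1 + 1, he.add_one, by omega, hlt.trans (by push_cast; linarith), ?_⟩
    intro p hp hxp
    have h1 := hge p hxp
    have h2 : p ≠ ⌊x⌋₊ + 1 := by
      rintro rfl
      have := hp.even_iff.1 he
      omega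
    omega
  · exact ⟨⌊x⌋₊ + 1, ho, by omega, hlt, fun p _ hp => hge p hp⟩

lemma sum_range_prime_tail_le {x : ℝ} {m : ℕ} (hodd : Odd m) (hm : 4 ≤ m)
    (hmin : ∀ p : ℕ, p.Prime → x < p → m ≤ p) (n : ℕ) :
    ∑ p ∈ Finset.range n,
      (if p.Prime ∧ x < (p : ℝ) then Real.log p / ((p : ℝ) * ((p : ℝ) - 1)) else 0) ≤
        (1 + Real.log m) / m := by
  have key : ∀ k : ℕ, ∑ p ∈ Finset.range (m + 2 * k),
      (if p.Prime ∧ x < (p : ℝ) then Real.log p / ((p : ℝ) * ((p : ℝ) - 1)) else 0) ≤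
        (1 + Real.log m) / m - (1 + Real.log (m + 2 * k : ℕ)) / (m + 2 * k : ℕ) := by
    intro k
    induction k with
    | zero =>
      rw [Finset.sum_eq_zero]
      · simp
      · intro p hp
        rw [if_neg]
        rintro ⟨h1, h2⟩
        have := hmin p h1 h2
        simp at hp
        omega
    | succ k ih =>
      have hnot : ¬ (m + 2 * k + 1).Prime := by
        intro hp
        have : Even (m + 2 * k + 1) := (hodd.add_even (even_two_mul k)).add_one
        have := hp.even_iff.1 this
        omega
      have hstep := log_div_mul_sub_one_le (t := (m + 2 * k : ℕ))
        (by exact_mod_cast (by omega : 4 ≤ m + 2 * k))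
      have hterm : (if (m + 2 * k).Prime ∧ x < ((m + 2 * k : ℕ) : ℝ) then
          Real.log (m + 2 * k : ℕ) / (((m + 2 * k : ℕ) : ℝ) * (((m + 2 * k : ℕ) : ℝ) - 1)) else 0) ≤
          Real.log (m + 2 * k : ℕ) /
            (((m + 2 * k : ℕ) : ℝ) * (((m + 2 * k : ℕ) : ℝ) - 1)) := by
        split_ifs
        · exact le_rfl
        · exact log_div_mul_sub_one_nonneg _
      have hcast : ((m + 2 * (k + 1) : ℕ) : ℝ) = ((m + 2 * k : ℕ) : ℝ) + 2 := by
        push_cast; ring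
      rw [hcast, show m + 2 * (k + 1) = m + 2 * k + 1 + 1 by ring, Finset.sum_range_succ,
        Finset.sum_range_succ, if_neg (c := (m + 2 * k + 1).Prime ∧ _) (fun h => hnot h.1)]
      linarith
  have hmono := Finset.sum_le_sum_of_subset_of_nonneg
    (Finset.range_mono (by omega : n ≤ m + 2 * n)) (fun p _ _ => prime_tail_nonneg x p)
  have hpos : 0 ≤ (1 + Real.log (m + 2 * n : ℕ)) / (m + 2 * n : ℕ) := by positivity
  linarith [key n]

lemma summable_prime_tail {x : ℝ} (hx : 3 ≤ x) :
    Summable fun p : ℕ =>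
      if p.Prime ∧ x < (p : ℝ) then Real.log p / ((p : ℝ) * ((p : ℝ) - 1)) else 0 := by
  obtain ⟨m, hodd, hm, -, hmin⟩ := exists_odd_gt_forall_prime_ge hx
  exact summable_of_sum_range_le (prime_tail_nonneg x) (sum_range_prime_tail_le hodd hm hmin)

lemma prime_tail_lt {x : ℝ} (hx : 3 ≤ x) :
    (∑' p : ℕ, if p.Prime ∧ x < (p : ℝ) then Real.log p / ((p : ℝ) * ((p : ℝ) - 1)) else 0) <
      (1 + Real.log x) / x := by
  obtain ⟨m, hodd, hm, hxm, hmin⟩ := exists_odd_gt_forall_prime_ge hx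
  exact (Real.tsum_le_of_sum_range_le (prime_tail_nonneg x)
    (sum_range_prime_tail_le hodd hm hmin)).trans_lt (one_add_log_div_lt (by linarith) hxm)

lemma prime_tail_pos {x : ℝ} (hx : 3 ≤ x) :
    0 < ∑' p : ℕ, if p.Prime ∧ x < (p : ℝ) then Real.log p / ((p : ℝ) * ((p : ℝ) - 1)) else 0 := by
  obtain ⟨p, hp, hprime⟩ := Nat.exists_infinite_primes (⌊x⌋₊ + 1)
  have hxp : x < p := (Nat.lt_floor_add_one x).trans_le (by exact_mod_cast hp)
  refine (summable_prime_tail hx).tsum_pos (prime_tail_nonneg x) p ?_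
  rw [if_pos ⟨hprime, hxp⟩]
  exact div_pos (Real.log_pos (by linarith)) (mul_pos (by linarith) (by linarith))

lemma mem_primesUpTo {x : ℝ} (hx : 0 ≤ x) {p : ℕ} :
    p ∈ primesUpTo x ↔ p.Prime ∧ (p : ℝ) ≤ x := by
  simp [primesUpTo, Nat.le_floor_iff hx, and_comm]

lemma delta_sub_eta {x : ℝ} (hx : 3 ≤ x) :
    delta x - eta x =
      ∑' p : ℕ, if p.Prime ∧ x < (p : ℝ) then Real.log p / ((p : ℝ) * ((p : ℝ) - 1)) else 0 := by
  have hmem {p : ℕ} := mem_primesUpTo (x := x) (by linarith) (p := p)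
  have hhead : HasSum (fun p : ℕ => if p ∈ primesUpTo x then
      Real.log p / ((p : ℝ) * ((p : ℝ) - 1)) else 0)
      (∑ p ∈ primesUpTo x, Real.log p / ((p : ℝ) * ((p : ℝ) - 1))) := by
    have h := hasSum_sum_of_ne_finset_zero (L := SummationFilter.unconditional ℕ)
      (s := primesUpTo x) (f := fun p : ℕ =>
      if p ∈ primesUpTo x then Real.log p / ((p : ℝ) * ((p : ℝ) - 1)) else 0)
      (fun p hp => if_neg hp)
    rwa [Finset.sum_congr rfl (fun p hp => if_pos hp)] at h
  have htotal := (hhead.add (summable_prime_tail hx).hasSum).tsum_eq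
  have hsplit : (∑' p : ℕ, if p.Prime then Real.log p / ((p : ℝ) * ((p : ℝ) - 1)) else 0) =
      ∑' p : ℕ, ((if p ∈ primesUpTo x then Real.log p / ((p : ℝ) * ((p : ℝ) - 1)) else 0) +
        if p.Prime ∧ x < (p : ℝ) then Real.log p / ((p : ℝ) * ((p : ℝ) - 1)) else 0) := by
    refine tsum_congr fun p => ?_
    by_cases hp : p.Prime <;> by_cases hpx : (p : ℝ) ≤ x <;>
      simp [hmem, hp, hpx, not_lt.2, lt_of_not_ge]
  have hfinite : ∑ p ∈ primesUpTo x, Real.log p / ((p : ℝ) - 1) =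
      ∑ p ∈ primesUpTo x, Real.log p / (p : ℝ) +
        ∑ p ∈ primesUpTo x, Real.log p / ((p : ℝ) * ((p : ℝ) - 1)) := by
    rw [← Finset.sum_add_distrib]
    refine Finset.sum_congr rfl fun p hp => ?_
    have h1 : (1 : ℝ) < p := by exact_mod_cast (hmem.1 hp).1.one_lt
    have h2 : (p : ℝ) - 1 ≠ 0 := by linarith
    have h3 : (p : ℝ) ≠ 0 := by linarith
    field_simp
    ring
  rw [delta, eta, hsplit, htotal, hfinite]
  ring

theorem tail_sum_bound (x : ℝ) (hx : 3 ≤ x) :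
    (0 < ∑' p : ℕ, if p.Prime ∧ x < (p : ℝ) then Real.log p / ((p : ℝ) * ((p : ℝ) - 1)) else 0) ∧
    (∑' p : ℕ, if p.Prime ∧ x < (p : ℝ) then Real.log p / ((p : ℝ) * ((p : ℝ) - 1)) else 0) <
        (1 + Real.log x) / x ∧
    0 < delta x - eta x ∧
    delta x - eta x < (1 + Real.log x) / x := by
  rw [delta_sub_eta hx]
  exact ⟨prime_tail_pos hx, prime_tail_lt hx, prime_tail_pos hx, prime_tail_lt hx⟩
end

section
/- For every prime q, W_q = −log(1 − 1/q)/q − Σ_{j ≥ 1} (q − 1)/(j·q^{j+1}·(q^{j+1} − 1)), where W_q := Σ_{h ≥ 1} ((1 − 1/q)/q^h)·log((1 − 1/q^{h+1})/(1 − 1/q)), and the series on the right converges. -/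
open scoped BigOperators

/-- The double series obtained by expanding `log (1 - x ^ (h + 2))` converges absolutely. -/
lemma summable_geometric_log_expansion {x : ℝ} (hx0 : 0 < x) (hx1 : x < 1) :
    Summable (fun p : ℕ × ℕ =>
      (1 - x) * x ^ (p.1 + 1) * ((x ^ (p.1 + 2)) ^ (p.2 + 1) / ((p.2 : ℝ) + 1))) := by
  have hg := summable_geometric_of_lt_one hx0.le hx1
  have hprod : Summable (fun p : ℕ × ℕ => x ^ p.1 * x ^ p.2) :=
    hg.mul_of_nonneg hg (fun n => pow_nonneg hx0.le n) (fun n => pow_nonneg hx0.le n)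
  have h1x : 0 < 1 - x := sub_pos.2 hx1
  refine Summable.of_nonneg_of_le (fun p => by positivity) (fun p => ?_) hprod
  have h1 : (1 - x) * x ^ (p.1 + 1) ≤ x ^ p.1 := by
    calc (1 - x) * x ^ (p.1 + 1) ≤ 1 * x ^ (p.1 + 1) := by gcongr; linarith
      _ ≤ x ^ p.1 := by
        rw [one_mul]
        exact pow_le_pow_of_le_one hx0.le hx1.le (by omega)
  have h2 : (x ^ (p.1 + 2)) ^ (p.2 + 1) / ((p.2 : ℝ) + 1) ≤ x ^ p.2 := by
    calc (x ^ (p.1 + 2)) ^ (p.2 + 1) / ((p.2 : ℝ) + 1)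
        ≤ (x ^ (p.1 + 2)) ^ (p.2 + 1) := div_le_self (by positivity) (by simp)
      _ ≤ x ^ p.2 := by
        rw [← pow_mul]
        exact pow_le_pow_of_le_one hx0.le hx1.le (by nlinarith)
  exact mul_le_mul h1 h2 (by positivity) (by positivity)

theorem W_series_identity (q : ℕ) (hq : q.Prime) :
    Summable (fun j : ℕ =>
      ((q : ℝ) - 1) / ((j + 1 : ℕ) * (q : ℝ) ^ (j + 2) * ((q : ℝ) ^ (j + 2) - 1))) ∧
    W q = -Real.log (1 - 1 / (q : ℝ)) / (q : ℝ) -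
      ∑' j : ℕ, ((q : ℝ) - 1) / ((j + 1 : ℕ) * (q : ℝ) ^ (j + 2) * ((q : ℝ) ^ (j + 2) - 1)) := by
  have hq1 : (1 : ℝ) < q := by exact_mod_cast hq.one_lt
  have hq0 : (0 : ℝ) < q := by linarith
  obtain ⟨x, hx⟩ : ∃ x : ℝ, x = 1 / (q : ℝ) := ⟨_, rfl⟩
  have hx0 : 0 < x := by rw [hx]; positivity
  have hx1 : x < 1 := by rw [hx, div_lt_one hq0]; exact hq1
  have hxpow (n : ℕ) : x ^ (n + 1) < 1 := pow_lt_one₀ hx0.le hx1 (by omega)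
  have hF := (summable_geometric_log_expansion hx0 hx1).hasSum
  have hrow (h : ℕ) : HasSum
      (fun j : ℕ => (1 - x) * x ^ (h + 1) * ((x ^ (h + 2)) ^ (j + 1) / ((j : ℝ) + 1)))
      ((1 - x) * x ^ (h + 1) * -Real.log (1 - x ^ (h + 2))) := by
    refine (Real.hasSum_pow_div_log_of_abs_lt_one ?_).mul_left _
    rw [abs_of_pos (by positivity)]
    exact hxpow (h + 1)
  have hcol (j : ℕ) : HasSum
      (fun h : ℕ => (1 - x) * x ^ (h + 1) * ((x ^ (h + 2)) ^ (j + 1) / ((j : ℝ) + 1)))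
      (((q : ℝ) - 1) / ((j + 1 : ℕ) * (q : ℝ) ^ (j + 2) * ((q : ℝ) ^ (j + 2) - 1))) := by
    have hgeo := (hasSum_geometric_of_lt_one (pow_nonneg hx0.le (j + 2)) (hxpow (j + 1))).mul_left
      ((1 - x) * x ^ (2 * j + 3) / ((j : ℝ) + 1))
    have hterm (h : ℕ) : (1 - x) * x ^ (2 * j + 3) / ((j : ℝ) + 1) * (x ^ (j + 2)) ^ h =
        (1 - x) * x ^ (h + 1) * ((x ^ (h + 2)) ^ (j + 1) / ((j : ℝ) + 1)) := by
      have hexp : x ^ (2 * j + 3) * (x ^ (j + 2)) ^ h = x ^ (h + 1) * (x ^ (h + 2)) ^ (j + 1) := by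
        ring
      linear_combination (1 - x) / ((j : ℝ) + 1) * hexp
    have hqp : (1 : ℝ) < (q : ℝ) ^ (j + 2) := one_lt_pow₀ hq1 (by omega)
    have hne : (q : ℝ) ^ (j + 2) - 1 ≠ 0 := (sub_pos.2 hqp).ne'
    have hinv : (1 - x ^ (j + 2))⁻¹ = (q : ℝ) ^ (j + 2) / ((q : ℝ) ^ (j + 2) - 1) := by
      rw [hx, one_div, inv_pow]
      field_simp
    have hval : (1 - x) * x ^ (2 * j + 3) / ((j : ℝ) + 1) * (1 - x ^ (j + 2))⁻¹ =
        ((q : ℝ) - 1) / ((j + 1 : ℕ) * (q : ℝ) ^ (j + 2) * ((q : ℝ) ^ (j + 2) - 1)) := by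
      rw [hinv, hx, one_div_pow]
      push_cast
      field_simp
      ring
    simpa only [hterm, hval] using hgeo
  have hrows := hF.prod_fiberwise hrow
  have hcols := ((Equiv.prodComm ℕ ℕ).hasSum_iff.2 hF).prod_fiberwise hcol
  refine ⟨hcols.summable, ?_⟩
  have hconst : HasSum (fun h : ℕ => (1 - x) * x ^ (h + 1) * -Real.log (1 - x))
      (x * -Real.log (1 - x)) := by
    have hgeo := (hasSum_geometric_of_lt_one hx0.le hx1).mul_left ((1 - x) * x)
    have hsum : (1 - x) * x * (1 - x)⁻¹ = x := by
      have : 1 - x ≠ 0 := by linarith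
      field_simp
    rw [hsum] at hgeo
    simpa only [pow_succ', mul_assoc] using hgeo.mul_right (-Real.log (1 - x))
  rw [hcols.tsum_eq]
  have hmain := (hconst.sub hrows).tsum_eq
  rw [← hx, show -Real.log (1 - x) / (q : ℝ) = x * -Real.log (1 - x) by rw [hx]; ring, ← hmain, W]
  refine tsum_congr fun h => ?_
  have hpow : 1 / (q : ℝ) ^ (h + 2) = x ^ (h + 2) := by rw [hx, one_div_pow]
  have hpow' : (1 - x) / (q : ℝ) ^ (h + 1) = (1 - x) * x ^ (h + 1) := by
    rw [hx, one_div_pow]; ring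
  have hlt := hxpow (h + 1)
  rw [← hx, hpow, hpow', Real.log_div (sub_pos.2 hlt).ne' (sub_pos.2 hx1).ne']
  ring
end

section
/- For every prime q and every positive integer J, the tail R_{q,J} := Σ_{j > J} (q − 1)/(j·q^{j+1}·(q^{j+1} − 1)) satisfies 0 < R_{q,J} < 1/(J·q^{2J+2}·(q + 1)). -/
open scoped BigOperators
open Classical

/-- `R_{q,J} = Σ_{j > J} (q − 1)/(j·q^{j+1}·(q^{j+1} − 1))`. -/
noncomputable def R (q J : ℕ) : ℝ :=
  ∑' j : ℕ, if J < j then ((q : ℝ) - 1) / ((j : ℝ) * (q : ℝ) ^ (j + 1) * ((q : ℝ) ^ (j + 1) - 1))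
    else 0

/-- The summand of `R q J` with index `n + 1`, bounded by a difference of consecutive bounds. -/
lemma R_summand_lt (q : ℝ) (hq : 2 ≤ q) (n : ℕ) (hn : 0 < n) :
    (q - 1) / (((n + 1 : ℕ) : ℝ) * q ^ (n + 1 + 1) * (q ^ (n + 1 + 1) - 1)) <
      1 / ((n : ℝ) * q ^ (2 * n + 2) * (q + 1)) -
        1 / (((n + 1 : ℕ) : ℝ) * q ^ (2 * (n + 1) + 2) * (q + 1)) := by
  have hn' : (0 : ℝ) < n := Nat.cast_pos.2 hn
  have hq0 : 0 < q := by linarith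
  obtain ⟨X, hX⟩ : ∃ X, X = q ^ (n + 1 + 1) := ⟨_, rfl⟩
  have hXn : (n : ℝ) + 1 < X := by
    have h1 : ((n + 1 + 1 : ℕ) : ℝ) < 2 ^ (n + 1 + 1) := by
      exact_mod_cast Nat.lt_two_pow_self
    have h2 : (2 : ℝ) ^ (n + 1 + 1) ≤ q ^ (n + 1 + 1) := by gcongr
    push_cast at h1
    linarith
  have e1 : q ^ (2 * (n + 1) + 2) = X ^ 2 := by rw [hX]; ring
  have e2 : q ^ (2 * n + 2) = X ^ 2 / q ^ 2 := by rw [hX]; field_simp; ring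
  rw [← hX, e1, e2]
  push_cast
  have hX0 : 0 < X := by linarith
  have hX1 : 0 < X - 1 := by linarith
  rw [← sub_pos]
  have key : 1 / ((n : ℝ) * (X ^ 2 / q ^ 2) * (q + 1)) - 1 / (((n : ℝ) + 1) * X ^ 2 * (q + 1)) -
      (q - 1) / (((n : ℝ) + 1) * X * (X - 1)) =
      ((X - 1) * q ^ 2 - n * (q ^ 2 - 1)) / (n * (n + 1) * X ^ 2 * (X - 1) * (q + 1)) := by
    have := hX1.ne'
    field_simp
    ring
  rw [key]
  apply div_pos _ (by positivity)
  nlinarith [mul_pos (sub_pos.2 hXn) (pow_pos hq0 2)]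

lemma tendsto_R_upper_bound (q : ℝ) (hq : 2 ≤ q) :
    Filter.Tendsto (fun n : ℕ => 1 / ((n : ℝ) * q ^ (2 * n + 2) * (q + 1))) Filter.atTop
      (nhds 0) := by
  refine squeeze_zero' (.of_forall fun n => by positivity) ?_
    tendsto_one_div_atTop_nhds_zero_nat
  filter_upwards [Filter.eventually_gt_atTop 0] with n hn
  have hn' : (0 : ℝ) < n := Nat.cast_pos.2 hn
  apply one_div_le_one_div_of_le hn'
  have h : 1 ≤ q ^ (2 * n + 2) := one_le_pow₀ (by linarith)
  rw [mul_assoc]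
  exact le_mul_of_one_le_right hn'.le (one_le_mul_of_one_le_of_one_le h (by linarith))

theorem R_bounds (q J : ℕ) (hq : q.Prime) (hJ : 0 < J) :
    0 < R q J ∧ R q J < 1 / ((J : ℝ) * (q : ℝ) ^ (2 * J + 2) * ((q : ℝ) + 1)) := by
  have hq2 : (2 : ℝ) ≤ q := by exact_mod_cast hq.two_le
  set f : ℕ → ℝ := fun n => 1 / ((n : ℝ) * (q : ℝ) ^ (2 * n + 2) * ((q : ℝ) + 1)) with hf
  set t : ℕ → ℝ := fun j => if J < j then
    ((q : ℝ) - 1) / ((j : ℝ) * (q : ℝ) ^ (j + 1) * ((q : ℝ) ^ (j + 1) - 1)) else 0 with ht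
  have t_pos (i : ℕ) : 0 < t (i + (J + 1)) := by
    have h1 : (1 : ℝ) < (q : ℝ) ^ (i + (J + 1) + 1) := one_lt_pow₀ (by linarith) (by omega)
    simp only [ht, if_pos (show J < i + (J + 1) by omega)]
    apply div_pos (by linarith)
    exact mul_pos (by positivity) (by linarith)
  have t_lt (i : ℕ) : t (i + (J + 1)) < f (i + J) - f (i + 1 + J) := by
    have h := R_summand_lt q hq2 (i + J) (by omega)
    simp only [ht, if_pos (show J < i + (J + 1) by omega)]
    rw [show i + 1 + J = i + J + 1 by omega]
    exact h
  have hsum : HasSum (fun i => f (i + J) - f (i + 1 + J)) (f J) := by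
    rw [hasSum_iff_tendsto_nat_of_nonneg fun i => ((t_pos i).trans (t_lt i)).le]
    have h := ((Filter.tendsto_add_atTop_iff_nat J).2
      (tendsto_R_upper_bound q hq2)).const_sub (f J)
    rw [sub_zero] at h
    refine h.congr fun n => ?_
    rw [Finset.sum_range_sub' (fun i => f (i + J)), Nat.zero_add]
  have hts : Summable fun i => t (i + (J + 1)) :=
    .of_nonneg_of_le (fun i => (t_pos i).le) (fun i => (t_lt i).le) hsum.summable
  have hR : R q J = ∑' i, t (i + (J + 1)) := by
    change ∑' j, t j = _
    rw [← ((summable_nat_add_iff (J + 1)).1 hts).sum_add_tsum_nat_add (J + 1),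
      Finset.sum_eq_zero, zero_add]
    intro j hj
    exact if_neg (by have := Finset.mem_range.1 hj; omega)
  rw [hR]
  refine ⟨hts.tsum_pos (fun i => (t_pos i).le) 0 (t_pos 0), ?_⟩
  exact (hts.tsum_lt_tsum (fun i => (t_lt i).le) (t_lt 0) hsum.summable).trans_eq hsum.tsum_eq
end

section
/- For every integer J ≥ 2: Σ_{q prime} R_{q,J} < 1/(J·2^{2J+3}), where R_{q,J} := Σ_{j > J} (q − 1)/(j·q^{j+1}·(q^{j+1} − 1)). -/
open scoped BigOperators
open Classical

lemma R_term_nonneg (q J j : ℕ) (hq : 2 ≤ q) :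
    0 ≤ (if J < j then ((q : ℝ) - 1) / ((j : ℝ) * (q : ℝ) ^ (j + 1) * ((q : ℝ) ^ (j + 1) - 1))
      else 0) := by
  have hq1 : (1 : ℝ) ≤ q := by exact_mod_cast (by omega : 1 ≤ q)
  have hpow : (1 : ℝ) ≤ (q : ℝ) ^ (j + 1) := one_le_pow₀ hq1
  split_ifs
  · exact div_nonneg (by linarith) (mul_nonneg (by positivity) (by linarith))
  · exact le_rfl

lemma R_nonneg (q J : ℕ) (hq : 2 ≤ q) : 0 ≤ R q J :=
  tsum_nonneg fun j => R_term_nonneg q J j hq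

lemma R_term_le (q J j : ℕ) (hq : 2 ≤ q) (hJ : 2 ≤ J) (hj : J < j) :
    ((q : ℝ) - 1) / ((j : ℝ) * (q : ℝ) ^ (j + 1) * ((q : ℝ) ^ (j + 1) - 1)) ≤
      16 / 15 / J / (q + 1) * (1 / ((q : ℝ) ^ 2) ^ j - 1 / ((q : ℝ) ^ 2) ^ (j + 1)) := by
  have hq2 : (2 : ℝ) ≤ q := by exact_mod_cast hq
  have hJ0 : (0 : ℝ) < J := by exact_mod_cast (by omega : 0 < J)
  have hJj : (J : ℝ) ≤ j := by exact_mod_cast hj.le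
  have h16 : (16 : ℝ) ≤ (q : ℝ) ^ (j + 1) := by
    calc (16 : ℝ) = 2 ^ 4 := by norm_num
      _ ≤ 2 ^ (j + 1) := pow_le_pow_right₀ (by norm_num) (by omega)
      _ ≤ (q : ℝ) ^ (j + 1) := by gcongr
  have htel : 16 / 15 / J / (q + 1) * (1 / ((q : ℝ) ^ 2) ^ j - 1 / ((q : ℝ) ^ 2) ^ (j + 1)) =
      ((q : ℝ) - 1) / (J * (q : ℝ) ^ (j + 1) * (15 / 16 * (q : ℝ) ^ (j + 1))) := by
    field_simp
    ring
  rw [htel]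
  gcongr
  · linarith
  · linarith

lemma R_le (q J : ℕ) (hq : 2 ≤ q) (hJ : 2 ≤ J) :
    R q J ≤ 16 / 15 / J / (q + 1) * (1 / ((q : ℝ) ^ 2) ^ (J + 1)) := by
  refine Real.tsum_le_of_sum_range_le (fun j => R_term_nonneg q J j hq) fun n => ?_
  refine (Finset.sum_le_sum_of_subset_of_nonneg
    (Finset.range_mono (by omega : n ≤ J + 1 + n))
    fun j _ _ => R_term_nonneg q J j hq).trans ?_
  have key : ∀ m : ℕ, ∑ j ∈ Finset.range (J + 1 + m),
      (if J < j then ((q : ℝ) - 1) / ((j : ℝ) * (q : ℝ) ^ (j + 1) * ((q : ℝ) ^ (j + 1) - 1))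
        else 0) ≤
      16 / 15 / J / (q + 1) * (1 / ((q : ℝ) ^ 2) ^ (J + 1) - 1 / ((q : ℝ) ^ 2) ^ (J + 1 + m)) := by
    intro m
    induction m with
    | zero =>
      rw [Finset.sum_eq_zero]
      · simp
      · intro j hj
        rw [if_neg (by have := Finset.mem_range.mp hj; omega)]
    | succ m ih =>
      rw [← add_assoc, Finset.sum_range_succ, if_pos (by omega)]
      have := R_term_le q J (J + 1 + m) hq hJ (by omega)
      linarith
  refine (key n).trans ?_
  gcongr
  exact sub_le_self _ (by positivity)

lemma R_le_four_pow (q k : ℕ) (hq : 2 ≤ q) :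
    R q (k + 2) ≤ 16 / 15 / ((k + 2 : ℕ) : ℝ) / 4 ^ k * (1 / ((q : ℝ) ^ 6 * (q + 1))) := by
  have hq2 : (2 : ℝ) ≤ q := by exact_mod_cast hq
  refine (R_le q (k + 2) hq (by omega)).trans ?_
  have hpow : (4 : ℝ) ^ k ≤ ((q : ℝ) ^ 2) ^ k := by
    gcongr
    nlinarith
  calc _ = 16 / 15 / ((k + 2 : ℕ) : ℝ) / ((q : ℝ) ^ 2) ^ k * (1 / ((q : ℝ) ^ 6 * (q + 1))) := by
        rw [show k + 2 + 1 = k + 3 by rfl, pow_add]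
        field_simp
    _ ≤ _ := by gcongr

lemma one_div_pow_six_mul_le (q : ℕ) (hq : 3 ≤ q) :
    1 / ((q : ℝ) ^ 6 * (q + 1)) ≤ 1 / 243 * (1 / (q : ℝ) - 1 / (q + 1)) := by
  have hq3 : (3 : ℝ) ≤ q := by exact_mod_cast hq
  have h5 : (243 : ℝ) ≤ (q : ℝ) ^ 5 := by
    calc (243 : ℝ) = 3 ^ 5 := by norm_num
      _ ≤ _ := by gcongr
  calc 1 / ((q : ℝ) ^ 6 * (q + 1)) = 1 / (q : ℝ) ^ 5 * (1 / (q : ℝ) - 1 / (q + 1)) := by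
        field_simp
        ring
    _ ≤ _ := by
        gcongr
        rw [sub_nonneg]
        gcongr
        linarith

lemma tsum_prime_R_le (k : ℕ) :
    (∑' q : ℕ, if q.Prime then R q (k + 2) else 0) ≤
      16 / 15 / ((k + 2 : ℕ) : ℝ) / 4 ^ k * (1 / 192 + 1 / 729) := by
  have hnn : ∀ q : ℕ, 0 ≤ if q.Prime then R q (k + 2) else 0 := by
    intro q
    split_ifs with h
    · exact R_nonneg q _ h.two_le
    · exact le_rfl
  refine Real.tsum_le_of_sum_range_le hnn fun n => ?_
  refine (Finset.sum_le_sum_of_subset_of_nonneg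
    (Finset.range_mono (by omega : n ≤ n + 3)) fun q _ _ => hnn q).trans ?_
  have key : ∀ m : ℕ, ∑ q ∈ Finset.range (m + 3), (if q.Prime then R q (k + 2) else 0) ≤
      16 / 15 / ((k + 2 : ℕ) : ℝ) / 4 ^ k *
        (1 / 192 + 1 / 243 * (1 / 3 - 1 / ((m + 3 : ℕ) : ℝ))) := by
    intro m
    induction m with
    | zero =>
      have h := R_le_four_pow 2 k le_rfl
      norm_num [Finset.sum_range_succ, Nat.prime_two, Nat.not_prime_zero,
        Nat.not_prime_one] at h ⊢
      exact h
    | succ m ih =>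
      rw [show m + 1 + 3 = (m + 3) + 1 by omega, Finset.sum_range_succ]
      have hterm : (if (m + 3).Prime then R (m + 3) (k + 2) else 0) ≤
          16 / 15 / ((k + 2 : ℕ) : ℝ) / 4 ^ k *
            (1 / 243 * (1 / ((m + 3 : ℕ) : ℝ) - 1 / (((m + 3 : ℕ) : ℝ) + 1))) := by
        have hle := one_div_pow_six_mul_le (m + 3) (by omega)
        have hmul := mul_le_mul_of_nonneg_left hle
          (by positivity : (0 : ℝ) ≤ 16 / 15 / ((k + 2 : ℕ) : ℝ) / 4 ^ k)
        split_ifs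
        · exact (R_le_four_pow (m + 3) k (by omega)).trans hmul
        · exact le_trans (by positivity) hmul
      rw [Nat.cast_succ (m + 3)]
      linarith
  refine (key n).trans ?_
  gcongr
  have : (0 : ℝ) ≤ 1 / ((n + 3 : ℕ) : ℝ) := by positivity
  linarith

theorem R_sum_over_primes_bound (J : ℕ) (hJ : 2 ≤ J) :
    (∑' q : ℕ, if q.Prime then R q J else 0) < 1 / ((J : ℝ) * 2 ^ (2 * J + 3)) := by
  obtain ⟨k, rfl⟩ := Nat.exists_eq_add_of_le' hJ
  refine (tsum_prime_R_le k).trans_lt ?_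
  have hrhs : 1 / (((k + 2 : ℕ) : ℝ) * 2 ^ (2 * (k + 2) + 3)) =
      1 / ((k + 2 : ℕ) : ℝ) / 4 ^ k * (1 / 128) := by
    rw [show 2 * (k + 2) + 3 = 2 * k + 7 by ring, pow_add, pow_mul]
    norm_num
    field_simp
  have hpos : (0 : ℝ) < 1 / ((k + 2 : ℕ) : ℝ) / 4 ^ k := by positivity
  have hlhs : 16 / 15 / ((k + 2 : ℕ) : ℝ) / 4 ^ k * (1 / 192 + 1 / 729) =
      1 / ((k + 2 : ℕ) : ℝ) / 4 ^ k * (16 / 15 * (1 / 192 + 1 / 729)) := by ring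
  rw [hrhs, hlhs]
  gcongr
  norm_num
end
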